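/- arXiv:2212.06530 — 4 statements merged into one kernel-verified Lean document; each statement's English description precedes it below -/
import Mathlib

section
/- For a tree T and a positive integer k, the Staller-Maker-Breaker domination number of the Staller-start game satisfies γ'_SMB(T) = k if and only if T contains a substructure from the family S_k and contains no substructure from S_1 ∪ ... ∪ S_{k-1}. -/
open scoped Classical


/-- `SStar k G VS X` says that the subgraph of `G` induced on the vertex set `VS`,
together with the distinguished vertex set `X ⊆ VS`, is a member of the family
`S_k^*` (defined recursively: `S_1^* = {P_1}` with `X` the single vertex; a member
of `S_{k}^*` for `k ≥ 2` is obtained from disjoint members `S^1 ∈ S_{k-1}^*` and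
`S^2 ∈ ∪_{i<k} S_i^*` by joining a new origin vertex `z` to chosen vertices
`x₁ ∈ X(S^1)` and `x₂ ∈ X(S^2)`, with `X = X(S^1) ∪ X(S^2)`). -/
def SStar {V : Type} : ℕ → SimpleGraph V → Set V → Set V → Prop
  | 0, _, _, _ => False
  | 1, _, VS, X => ∃ x : V, VS = {x} ∧ X = {x}
  | (k+2), G, VS, X => ∃ (z : V) (A B : Set V) (x₁ x₂ : V),
      z ∈ VS ∧ z ∉ X ∧ X ⊆ VS ∧ A ∪ B = VS \ {z} ∧ Disjoint A B ∧
      x₁ ∈ A ∩ X ∧ x₂ ∈ B ∩ X ∧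
      (∀ v ∈ VS, G.Adj z v ↔ (v = x₁ ∨ v = x₂)) ∧
      (∀ a ∈ A, ∀ b ∈ B, ¬ G.Adj a b) ∧
      SStar (k+1) G A (X ∩ A) ∧
      (∃ i, ∃ _ : 1 ≤ i ∧ i ≤ k + 1, SStar i G B (X ∩ B))
termination_by k _ _ _ => k
decreasing_by all_goals omega

/-- The subgraph of `G` induced on `VS` with distinguished set `X` is a member of
the family `S_k = S_k^* \ (S_1 ∪ ⋯ ∪ S_{k-1})`. -/
def SFamilyAt (k : ℕ) {V : Type} (G : SimpleGraph V) (VS X : Set V) : Prop :=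
  SStar k G VS X ∧ ∀ i < k, ¬ SStar i G VS X

/-- The graph `G` itself, with distinguished set `X`, is a member of the family `S_k`. -/
def SFamily (k : ℕ) {V : Type} (G : SimpleGraph V) (X : Set V) : Prop :=
  SFamilyAt k G Set.univ X

/-- `G` contains a substructure from `S_k`: a subgraph (induced on some vertex set
`VS`, with distinguished set `X`) belonging to `S_k` such that every vertex of `X`
has the same degree in the subgraph as in `G`, i.e. all `G`-neighbors of vertices
of `X` lie in `VS`. -/
def HasSubstructure (k : ℕ) {V : Type} (G : SimpleGraph V) : Prop :=
  ∃ VS X : Set V, SFamilyAt k G VS X ∧ ∀ x ∈ X, ∀ w : V, G.Adj x w → w ∈ VS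

open scoped Classical

noncomputable section

/-- Minimax value of the Maker–Breaker game on hypergraph with edge set `E`:
`mbVal E t M B` is the minimum number of further moves Maker needs to claim all
vertices of some hyperedge (Maker has claimed `M`, Breaker has claimed `B`,
`t = true` iff Maker moves next), under optimal play; `⊤` if Maker cannot win. -/
def mbVal {V : Type} [Fintype V] (E : Set (Finset V)) :
    Bool → Finset V → Finset V → ℕ∞
  | true, M, B =>
      if ∃ e ∈ E, e ⊆ M then 0
      else ⨅ v ∈ Finset.univ \ (M ∪ B), (1 + mbVal E false (insert v M) B)
  | false, M, B =>
      if ∃ e ∈ E, e ⊆ M then 0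
      else if Finset.univ \ (M ∪ B) = ∅ then ⊤
      else ⨆ v ∈ Finset.univ \ (M ∪ B), mbVal E true M (insert v B)
termination_by _t M B => (Finset.univ \ (M ∪ B)).card
decreasing_by
  all_goals
    apply Finset.card_lt_card
    rw [Finset.ssubset_iff_of_subset]
    · refine ⟨v, ‹_›, by simp⟩
    · intro x hx
      simp only [Finset.mem_sdiff, Finset.mem_univ, true_and, Finset.mem_union,
        Finset.mem_insert] at hx ⊢
      tauto

/-- The closed neighborhood of `v` as a finset. -/
def closedNbhdFinset {V : Type} [Fintype V] (G : SimpleGraph V) (v : V) : Finset V :=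
  Finset.univ.filter (fun w => w = v ∨ G.Adj v w)

/-- The closed neighborhood hypergraph of a graph. -/
def nbhdHyp {V : Type} [Fintype V] (G : SimpleGraph V) : Set (Finset V) :=
  Set.range (closedNbhdFinset G)

/-- `γ'_SMB(G)`: the number of moves Staller (= Maker on the closed neighborhood
hypergraph, moving first) needs to win the Maker–Breaker domination game on `G`. -/
def gammaSMB' {V : Type} [Fintype V] (G : SimpleGraph V) : ℕ∞ :=
  mbVal (nbhdHyp G) true ∅ ∅

end


section

variable {V : Type} {G : SimpleGraph V}

theorem SStar.one_le {k : ℕ} {VS X : Set V} (h : SStar k G VS X) : 1 ≤ k := by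
  rcases k with _ | k
  · simp [SStar] at h
  · omega

theorem SStar.subset {k : ℕ} {VS X : Set V} (h : SStar k G VS X) : X ⊆ VS := by
  match k with
  | 0 => simp [SStar] at h
  | 1 =>
    rw [SStar] at h
    obtain ⟨x, rfl, rfl⟩ := h
    exact subset_rfl
  | k + 2 =>
    rw [SStar] at h
    obtain ⟨z, A, B, x₁, x₂, -, -, h, -⟩ := h
    exact h

theorem SStar.induce_preconnected {k : ℕ} {VS X : Set V} (h : SStar k G VS X) :
    (G.induce VS).Preconnected := by
  induction k using Nat.strong_induction_on generalizing VS X with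
  | _ k ih =>
    match k with
    | 0 => simp [SStar] at h
    | 1 =>
      rw [SStar] at h
      obtain ⟨x, rfl, -⟩ := h
      exact SimpleGraph.Preconnected.of_subsingleton
    | k + 2 =>
      rw [SStar] at h
      obtain ⟨z, A, B, x₁, x₂, hz, -, hX, hAB, -, h₁, h₂, hadj, -, hA, i, hi, hB⟩ := h
      have hVS : A ∪ ({z} ∪ B) = VS := by
        rw [Set.union_left_comm, hAB]
        simpa using Set.insert_eq_of_mem hz
      have hx₁ : G.Adj x₁ z := ((hadj x₁ (hX h₁.2)).2 (Or.inl rfl)).symm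
      have hx₂ : G.Adj z x₂ := (hadj x₂ (hX h₂.2)).2 (Or.inr rfl)
      have hzB := SimpleGraph.connected_induce_union (s := {z})
        SimpleGraph.Preconnected.of_subsingleton (ih i (by omega) hB) rfl h₂.1 hx₂
      rw [← hVS]
      exact (SimpleGraph.connected_induce_union (ih (k + 1) (by omega) hA) hzB.preconnected
        h₁.1 (Or.inl rfl) hx₁).preconnected

/-- In a forest, a vertex outside a connected set has at most one neighbor in it. -/
theorem SimpleGraph.IsAcyclic.eq_of_adj_of_induce_preconnected (hG : G.IsAcyclic) {S : Set V}
    (hS : (G.induce S).Preconnected) {v x y : V} (hv : v ∉ S) (hx : x ∈ S) (hy : y ∈ S)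
    (hvx : G.Adj v x) (hvy : G.Adj v y) : x = y := by
  obtain ⟨p⟩ := hS ⟨y, hy⟩ ⟨x, hx⟩
  have hb := SimpleGraph.isAcyclic_iff_forall_adj_isBridge.1 hG hvx
  rw [SimpleGraph.isBridge_iff_forall_walk_mem_edges] at hb
  let f : G.induce S →g G := ⟨Subtype.val, fun h => h⟩
  have h := hb (SimpleGraph.Walk.cons hvy (p.map f))
  rcases List.mem_cons.1 h with h | h
  · rcases Sym2.eq_iff.1 h with h | h
    exacts [h.2, absurd h.1 hvy.ne]
  · have := SimpleGraph.Walk.fst_mem_support_of_mem_edges _ h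
    rw [SimpleGraph.Walk.support_map, List.mem_map] at this
    obtain ⟨w, -, rfl⟩ := this
    exact absurd w.2 hv

/-- Two disjoint structures hanging from a common vertex of a forest can be joined there. -/
theorem SStar.join (hG : G.IsAcyclic) {i j : ℕ} {A B X Y : Set V} {v x y : V}
    (hA : SStar i G A X) (hB : SStar j G B Y) (hji : j ≤ i) (hAB : Disjoint A B)
    (hvA : v ∉ A) (hvB : v ∉ B) (hx : x ∈ X) (hy : y ∈ Y) (hvx : G.Adj v x) (hvy : G.Adj v y) :
    SStar (i + 1) G (insert v (A ∪ B)) (X ∪ Y) := by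
  obtain ⟨i, rfl⟩ := Nat.exists_eq_add_of_le' hA.one_le
  have hXA := hA.subset
  have hYB := hB.subset
  have hdis := Set.disjoint_left.1 hAB
  have e₁ : (X ∪ Y) ∩ A = X := by
    ext w; simp only [Set.mem_inter_iff, Set.mem_union]
    exact ⟨fun h => h.1.resolve_right fun h' => hdis h.2 (hYB h'), fun h => ⟨Or.inl h, hXA h⟩⟩
  have e₂ : (X ∪ Y) ∩ B = Y := by
    ext w; simp only [Set.mem_inter_iff, Set.mem_union]
    exact ⟨fun h => h.1.resolve_left fun h' => hdis (hXA h') h.2, fun h => ⟨Or.inr h, hYB h⟩⟩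
  rw [SStar]
  refine ⟨v, A, B, x, y, Set.mem_insert _ _, ?_, ?_, ?_, hAB, ⟨hXA hx, Or.inl hx⟩,
    ⟨hYB hy, Or.inr hy⟩, ?_, ?_, by rwa [e₁], j, ⟨hB.one_le, hji⟩, by rwa [e₂]⟩
  · rintro (h | h)
    exacts [hvA (hXA h), hvB (hYB h)]
  · exact (Set.union_subset_union hXA hYB).trans (Set.subset_insert _ _)
  · refine (Set.insert_sdiff_self_of_notMem ?_).symm
    rintro (h | h)
    exacts [hvA h, hvB h]
  · rintro w (rfl | hw | hw)
    · simp only [SimpleGraph.irrefl, false_iff]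
      rintro (rfl | rfl)
      exacts [hvA (hXA hx), hvB (hYB hy)]
    · refine ⟨fun h => Or.inl ?_, ?_⟩
      · exact hG.eq_of_adj_of_induce_preconnected hA.induce_preconnected hvA hw (hXA hx) h hvx
      · rintro (rfl | rfl) <;> assumption
    · refine ⟨fun h => Or.inr ?_, ?_⟩
      · exact hG.eq_of_adj_of_induce_preconnected hB.induce_preconnected hvB hw (hYB hy) h hvy
      · rintro (rfl | rfl) <;> assumption
  · intro a ha b hb hab
    have hc := SimpleGraph.connected_induce_union hA.induce_preconnected hB.induce_preconnected
      ha hb hab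
    have := hG.eq_of_adj_of_induce_preconnected hc.preconnected (v := v) (x := x) (y := y)
      (by rintro (h | h) <;> contradiction) (Or.inl (hXA hx)) (Or.inr (hYB hy)) hvx hvy
    exact hdis (hXA hx) (this ▸ hYB hy)

/-- In the position where Maker has claimed `M` and Breaker has claimed `B`, the unclaimed
vertices contain a member of `S_k^*` such that all other neighbors of its distinguished vertices
belong to Maker. -/
def HasResidualSubstructure (k : ℕ) (G : SimpleGraph V) (M B : Finset V) : Prop :=
  ∃ VS X : Set V, SStar k G VS X ∧ (∀ v ∈ VS, v ∉ M ∧ v ∉ B) ∧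
    ∀ x ∈ X, ∀ w, G.Adj x w → w ∈ VS ∨ w ∈ M

theorem HasResidualSubstructure.mono {k : ℕ} {M B B' : Finset V} (hB : B ⊆ B')
    (h : HasResidualSubstructure k G M B') : HasResidualSubstructure k G M B := by
  obtain ⟨VS, X, hS, hd, hc⟩ := h
  exact ⟨VS, X, hS, fun v hv => ⟨(hd v hv).1, fun h => (hd v hv).2 (hB h)⟩, hc⟩

/-- A residual substructure that appears when Maker claims `v` is either already present before
that move, or has a distinguished vertex adjacent to `v`. -/
theorem HasResidualSubstructure.of_insert_of_forall_not_adj {k : ℕ} {M B : Finset V} {v : V}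
    {VS X : Set V} (hS : SStar k G VS X) (hd : ∀ w ∈ VS, w ∉ insert v M ∧ w ∉ B)
    (hc : ∀ x ∈ X, ∀ w, G.Adj x w → w ∈ VS ∨ w ∈ insert v M) (hv : ∀ x ∈ X, ¬ G.Adj v x) :
    HasResidualSubstructure k G M B := by
  refine ⟨VS, X, hS, fun w hw => ⟨fun h => (hd w hw).1 (Finset.mem_insert_of_mem h),
    (hd w hw).2⟩, fun x hx w hxw => (hc x hx w hxw).imp_right fun h => ?_⟩
  rcases Finset.mem_insert.1 h with rfl | h
  · exact absurd hxw.symm (hv x hx)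
  · exact h

/-- Joining, at an unclaimed vertex `v`, two disjoint residual substructures that appear when
Maker claims `v`. -/
theorem HasResidualSubstructure.join (hG : G.IsAcyclic) {i j : ℕ} {M B : Finset V}
    {A C X Y : Set V} {v x y : V} (hA : SStar i G A X) (hC : SStar j G C Y) (hAC : Disjoint A C)
    (hvM : v ∉ M) (hvB : v ∉ B) (hdA : ∀ w ∈ A, w ∉ insert v M ∧ w ∉ B)
    (hdC : ∀ w ∈ C, w ∉ insert v M ∧ w ∉ B)
    (hcA : ∀ x ∈ X, ∀ w, G.Adj x w → w ∈ A ∨ w ∈ insert v M)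
    (hcC : ∀ x ∈ Y, ∀ w, G.Adj x w → w ∈ C ∨ w ∈ insert v M)
    (hx : x ∈ X) (hy : y ∈ Y) (hvx : G.Adj v x) (hvy : G.Adj v y) :
    HasResidualSubstructure (max i j + 1) G M B := by
  wlog hji : j ≤ i generalizing i j A C X Y x y
  · rw [max_comm]
    exact this hC hA hAC.symm hdC hdA hcC hcA hy hx hvy hvx (by omega)
  rw [max_eq_left hji]
  simp only [Finset.mem_insert, not_or] at *
  refine ⟨insert v (A ∪ C), X ∪ Y, hA.join hG hC hji hAC (fun h => (hdA v h).1.1 rfl)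
    (fun h => (hdC v h).1.1 rfl) hx hy hvx hvy, ?_, ?_⟩
  · rintro w (rfl | hw | hw)
    exacts [⟨hvM, hvB⟩, ⟨(hdA w hw).1.2, (hdA w hw).2⟩, ⟨(hdC w hw).1.2, (hdC w hw).2⟩]
  · simp only [Set.mem_insert_iff, Set.mem_union]
    rintro u (hu | hu) w huw
    · have := hcA u hu w huw
      tauto
    · have := hcC u hu w huw
      tauto

section Game

variable [Fintype V]

theorem exists_nbhdHyp_subset_iff {M : Finset V} :
    (∃ e ∈ nbhdHyp G, e ⊆ M) ↔ ∃ c ∈ M, ∀ w, G.Adj c w → w ∈ M := by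
  simp only [nbhdHyp, Set.exists_range_iff, closedNbhdFinset, Finset.subset_iff,
    Finset.mem_filter_univ, forall_eq_or_imp]

theorem not_exists_nbhdHyp_subset {M B : Finset V} (hMB : Disjoint M B)
    (hM : ∀ c ∈ M, ∃ w ∈ B, G.Adj c w) : ¬ ∃ e ∈ nbhdHyp G, e ⊆ M := by
  rw [exists_nbhdHyp_subset_iff]
  rintro ⟨c, hc, h⟩
  obtain ⟨w, hw, hcw⟩ := hM c hc
  exact Finset.disjoint_left.1 hMB (h w hcw) hw

theorem HasResidualSubstructure.mbVal_le {k : ℕ} {M B : Finset V}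
    (h : HasResidualSubstructure k G M B) : mbVal (nbhdHyp G) true M B ≤ k := by
  induction k using Nat.strong_induction_on generalizing M B with
  | _ k ih =>
    obtain ⟨VS, X, hS, hd, hc⟩ := h
    rw [mbVal]
    split_ifs with he
    · exact zero_le
    match k with
    | 0 => exact absurd hS.one_le (by simp)
    | 1 =>
      rw [SStar] at hS
      obtain ⟨x, rfl, rfl⟩ := hS
      have hxM : ∃ e ∈ nbhdHyp G, e ⊆ insert x M := by
        rw [exists_nbhdHyp_subset_iff]
        refine ⟨x, by simp, fun w hw => ?_⟩
        simpa using hc x rfl w hw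
      refine (iInf₂_le x (by simpa using hd x rfl)).trans ?_
      rw [mbVal, if_pos hxM]
      simp
    | k + 2 =>
      rw [SStar] at hS
      obtain ⟨z, C, D, x₁, x₂, hz, -, hX, hCD, hdis, h₁, h₂, -, hno, hC, i, hi, hD⟩ := hS
      refine (iInf₂_le z (by simpa using hd z hz)).trans ?_
      have hfalse : mbVal (nbhdHyp G) false (insert z M) B ≤ (k + 1 : ℕ) := by
        have hmem : ∀ w, w ∈ VS ↔ w = z ∨ w ∈ C ∨ w ∈ D := fun w => by
          have := Set.ext_iff.1 hCD w
          simp only [Set.mem_union, Set.mem_sdiff, Set.mem_singleton_iff] at this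
          by_cases hw : w = z
          · simp [hw, hz]
          · tauto
        have hzCD : z ∉ C ∧ z ∉ D := by
          have := Set.ext_iff.1 hCD z
          simpa using this
        have key : ∀ (E F : Set V) (j : ℕ) (b : V), j ≤ k + 1 → SStar j G E (X ∩ E) → z ∉ E →
            (∀ w, w ∈ VS ↔ w = z ∨ w ∈ E ∨ w ∈ F) → (∀ a ∈ E, ∀ b ∈ F, ¬ G.Adj a b) → b ∉ E →
            mbVal (nbhdHyp G) true (insert z M) (insert b B) ≤ (k + 1 : ℕ) := by
          intro E F j b hj hE hzE hm hn hb
          refine (ih j (by omega) ⟨E, X ∩ E, hE, fun w hw => ?_, fun x hx w hxw => ?_⟩).trans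
            (by exact_mod_cast hj)
          · have := hd w ((hm w).2 (Or.inr (Or.inl hw)))
            have hwz : w ≠ z := fun h => hzE (h ▸ hw)
            have hwb : w ≠ b := fun h => hb (h ▸ hw)
            simp [this, hwz, hwb]
          · have hnot := hn x hx.2 w
            have := hc x hx.1 w hxw
            rw [hm] at this
            rw [Finset.mem_insert]
            tauto
        rw [mbVal]
        split_ifs with he' hfree
        · exact zero_le
        · exfalso
          have hx₁ : x₁ ∈ Finset.univ \ (insert z M ∪ B) := by
            have := hd x₁ (hX h₁.2)
            have hne : x₁ ≠ z := fun h => hzCD.1 (h ▸ h₁.1)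
            simp [this, hne]
          exact Finset.notMem_empty x₁ (hfree ▸ hx₁)
        · refine iSup₂_le fun b _ => ?_
          by_cases hb : b ∈ C
          · exact key D C i b hi.2 hD hzCD.2 (fun w => by rw [hmem]; tauto)
              (fun a ha b hb h => hno b hb a ha h.symm) (Set.disjoint_left.1 hdis hb)
          · exact key C D (k + 1) b le_rfl hC hzCD.1 hmem hno hb
      calc 1 + mbVal (nbhdHyp G) false (insert z M) B ≤ 1 + ((k + 1 : ℕ) : ℕ∞) := by gcongr
        _ = ((k + 2 : ℕ) : ℕ∞) := by push_cast; ring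

/-- Breaker's reply to Maker's move `v`, when no residual substructure of rank at most `k + 1` was
available to Maker: it destroys every residual substructure of rank at most `k`, and Breaker then
owns a neighbor of `v`. -/
theorem exists_breaker_reply (hG : G.IsAcyclic) {k : ℕ} {M B : Finset V} {v : V}
    (hvM : v ∉ M) (hvB : v ∉ B) (hno : ∀ i ≤ k + 1, ¬ HasResidualSubstructure i G M B)
    (hfree : (Finset.univ \ (insert v M ∪ B)).Nonempty) :
    ∃ b ∈ Finset.univ \ (insert v M ∪ B), (∃ w ∈ insert b B, G.Adj v w) ∧
      ∀ i ≤ k, ¬ HasResidualSubstructure i G (insert v M) (insert b B) := by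
  by_cases hex : ∃ i ≤ k, HasResidualSubstructure i G (insert v M) B
  · obtain ⟨i, hi, VS, X, hS, hd, hc⟩ := hex
    obtain ⟨x, hx, hvx⟩ : ∃ x ∈ X, G.Adj v x := by
      by_contra! h
      exact hno i (by omega) (.of_insert_of_forall_not_adj hS hd hc h)
    have hxS := hS.subset hx
    have hvS : v ∉ VS := fun h => (hd v h).1 (Finset.mem_insert_self _ _)
    refine ⟨x, by simpa [not_or, and_assoc] using hd x hxS, ⟨x, by simp, hvx⟩, ?_⟩
    rintro j hj ⟨VS', X', hS', hd', hc'⟩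
    have hdB' : ∀ w ∈ VS', w ∉ insert v M ∧ w ∉ B := fun w hw =>
      ⟨(hd' w hw).1, fun h => (hd' w hw).2 (Finset.mem_insert_of_mem h)⟩
    obtain ⟨y, hy, hvy⟩ : ∃ y ∈ X', G.Adj v y := by
      by_contra! h
      exact hno j (by omega) (.of_insert_of_forall_not_adj hS' hdB' hc' h)
    have hyS := hS'.subset hy
    have hvS' : v ∉ VS' := fun h => (hd' v h).1 (Finset.mem_insert_self _ _)
    have hxS' : x ∉ VS' := fun h => (hd' x h).2 (Finset.mem_insert_self _ _)
    have hdis : Disjoint VS VS' := by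
      rw [Set.disjoint_iff_inter_eq_empty]
      by_contra hne
      have hconn := SimpleGraph.induce_union_connected hS.induce_preconnected
        hS'.induce_preconnected (Set.nonempty_iff_ne_empty.2 hne)
      have := hG.eq_of_adj_of_induce_preconnected hconn.preconnected (v := v) (x := x) (y := y)
        (by rintro (h | h) <;> contradiction) (Or.inl hxS) (Or.inr hyS) hvx hvy
      exact hxS' (this ▸ hyS)
    exact hno _ (by omega) (.join hG hS hS' hdis hvM hvB hd hdB' hc hc' hx hy hvx hvy)
  · push Not at hex
    have hkill : ∀ b, ∀ i ≤ k, ¬ HasResidualSubstructure i G (insert v M) (insert b B) :=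
      fun b i hi h => hex i hi (h.mono (Finset.subset_insert _ _))
    obtain ⟨u, hvu, huM⟩ : ∃ u, G.Adj v u ∧ u ∉ M := by
      by_contra! h
      refine hno 1 (by omega) ⟨{v}, {v}, by rw [SStar]; exact ⟨v, rfl, rfl⟩, ?_, ?_⟩
      · rintro _ rfl
        exact ⟨hvM, hvB⟩
      · rintro _ rfl w hw
        exact Or.inr (h w hw)
    by_cases huB : u ∈ B
    · obtain ⟨b, hb⟩ := hfree
      exact ⟨b, hb, ⟨u, Finset.mem_insert_of_mem huB, hvu⟩, hkill b⟩
    · exact ⟨u, by simp [huM, huB, hvu.ne'], ⟨u, by simp, hvu⟩, hkill u⟩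

theorem add_one_le_mbVal (hG : G.IsAcyclic) {k : ℕ} {M B : Finset V} (hMB : Disjoint M B)
    (hno : ∀ i ≤ k, ¬ HasResidualSubstructure i G M B) (hM : ∀ c ∈ M, ∃ w ∈ B, G.Adj c w) :
    ((k + 1 : ℕ) : ℕ∞) ≤ mbVal (nbhdHyp G) true M B := by
  induction k generalizing M B with
  | zero =>
    rw [mbVal, if_neg (not_exists_nbhdHyp_subset hMB hM)]
    exact le_iInf₂ fun v _ => by simp
  | succ k ih =>
    rw [mbVal, if_neg (not_exists_nbhdHyp_subset hMB hM)]
    refine le_iInf₂ fun v hv => ?_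
    simp only [Finset.mem_sdiff, Finset.mem_univ, true_and, Finset.mem_union, not_or] at hv
    rw [Nat.cast_succ, add_comm]
    gcongr
    rw [mbVal]
    split_ifs with he hfree
    · exfalso
      rw [exists_nbhdHyp_subset_iff] at he
      obtain ⟨c, hc, h⟩ := he
      rcases Finset.mem_insert.1 hc with rfl | hc
      · refine hno 1 (by omega) ⟨{c}, {c}, by rw [SStar]; exact ⟨c, rfl, rfl⟩, ?_, ?_⟩
        · rintro _ rfl
          exact hv
        · rintro _ rfl w hw
          simpa using h w hw
      · obtain ⟨w, hw, hcw⟩ := hM c hc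
        rcases Finset.mem_insert.1 (h w hcw) with rfl | hwM
        exacts [hv.2 hw, Finset.disjoint_left.1 hMB hwM hw]
    · exact le_top
    · obtain ⟨b, hb, ⟨w, hw, hvw⟩, hkill⟩ :=
        exists_breaker_reply hG hv.1 hv.2 hno (Finset.nonempty_iff_ne_empty.2 hfree)
      refine le_iSup₂_of_le b hb (ih ?_ hkill ?_)
      · simp only [Finset.mem_sdiff, Finset.mem_univ, true_and, Finset.mem_union, not_or] at hb
        rw [Finset.disjoint_insert_right, Finset.disjoint_insert_left]
        exact ⟨hb.1, hv.2, hMB⟩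
      · intro c hc
        rcases Finset.mem_insert.1 hc with rfl | hc
        · exact ⟨w, hw, hvw⟩
        · obtain ⟨u, hu, hcu⟩ := hM c hc
          exact ⟨u, Finset.mem_insert_of_mem hu, hcu⟩

theorem gammaSMB'_le_iff (hG : G.IsAcyclic) (k : ℕ) :
    gammaSMB' G ≤ k ↔ ∃ i ≤ k, HasSubstructure i G := by
  constructor
  · intro h
    by_contra! hno
    have := add_one_le_mbVal hG (k := k) (M := ∅) (B := ∅) (by simp) ?_ (by simp)
    · exact absurd (Nat.cast_le.1 (this.trans h)) (by omega)
    · rintro i hi ⟨VS, X, hS, -, hc⟩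
      have hex : ∃ j, SStar j G VS X := ⟨i, hS⟩
      refine hno (Nat.find hex) ((Nat.find_min' hex hS).trans hi) ⟨VS, X,
        ⟨Nat.find_spec hex, fun j hj => Nat.find_min hex hj⟩, fun x hx w hxw => ?_⟩
      simpa using hc x hx w hxw
  · rintro ⟨i, hi, VS, X, hS, hc⟩
    have : HasResidualSubstructure i G ∅ ∅ :=
      ⟨VS, X, hS.1, by simp, fun x hx w hxw => Or.inl (hc x hx w hxw)⟩
    exact this.mbVal_le.trans (Nat.cast_le.2 hi)

end Game

end

/-- For a tree `T` and a positive integer `k`, `γ'_SMB(T) = k` holds if and only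
if `T` contains a substructure from the family `S_k` and no substructure from
`S_1 ∪ ⋯ ∪ S_{k-1}`. -/
theorem stmt_7 {V : Type} [Fintype V] (T : SimpleGraph V) (hT : T.IsTree)
    (k : ℕ) (hk : 1 ≤ k) :
    gammaSMB' T = (k : ℕ∞) ↔
      (HasSubstructure k T ∧ ∀ i, 1 ≤ i → i < k → ¬ HasSubstructure i T) := by
  have hle := gammaSMB'_le_iff hT.isAcyclic
  constructor
  · intro h
    have hno : ∀ i, i < k → ¬ HasSubstructure i T := fun i hik hi =>
      absurd (Nat.cast_le.1 (h ▸ (hle i).2 ⟨i, le_rfl, hi⟩)) (by omega)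
    obtain ⟨j, hjk, hj⟩ := (hle k).1 h.le
    obtain rfl : j = k := hjk.eq_of_not_lt fun hlt => hno j hlt hj
    exact ⟨hj, fun i _ => hno i⟩
  · rintro ⟨hk, hno⟩
    refine ((hle k).2 ⟨k, le_rfl, hk⟩).eq_of_not_lt fun hlt => ?_
    obtain ⟨n, hn⟩ := ENat.ne_top_iff_exists.1 hlt.ne_top
    obtain ⟨j, hjn, VS, X, hS, hc⟩ := (hle n).1 hn.ge
    have hnk : n < k := Nat.cast_lt.1 (hn ▸ hlt)
    exact hno j hS.1.one_le (by omega) ⟨VS, X, hS, hc⟩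
end

section
/- Let S(n_1, ..., n_ℓ) be the subdivided star obtained from paths P_{n_1}, ..., P_{n_ℓ} by adding a central vertex adjacent to one end of each path. If at least two of the n_i are odd and n_1, n_2 are the two smallest odd values among them, then γ'_SMB(S(n_1, ..., n_ℓ)) = ⌈log_2(n_1 + n_2 + 1)⌉. -/
open scoped Classical

open scoped Classical

/-- The subdivided star `S(n 0, …, n (ℓ-1))`: `ℓ` vertex-disjoint paths
(branches) of orders `n 0, …, n (ℓ-1)` together with a central vertex (`none`)
adjacent to one endpoint of each branch. -/
def subdividedStar (ℓ : ℕ) (n : ℕ → ℕ) :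
    SimpleGraph (Option (Σ i : Fin ℓ, Fin (n i))) :=
  SimpleGraph.fromRel (fun a b =>
    (∃ (i : Fin ℓ) (h : 0 < n i), a = none ∧ b = some ⟨i, ⟨0, h⟩⟩) ∨
    (∃ (i : Fin ℓ) (j : Fin (n i)) (hj : (j : ℕ) + 1 < n i),
      a = some ⟨i, j⟩ ∧ b = some ⟨i, ⟨(j : ℕ) + 1, hj⟩⟩))


section Game

variable {V : Type} [Fintype V] {E : Set (Finset V)}

theorem mbVal_true_le {M B : Finset V} {v : V} (hM : v ∉ M) (hB : v ∉ B) :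
    mbVal E true M B ≤ 1 + mbVal E false (insert v M) B := by
  rw [mbVal]
  split_ifs
  · exact zero_le
  · exact iInf₂_le v (by simp [hM, hB])

theorem mbVal_false_eq_zero {M B : Finset V} (h : ∃ e ∈ E, e ⊆ M) :
    mbVal E false M B = 0 := by
  rw [mbVal, if_pos h]

theorem mbVal_false_le {M B : Finset V} {v : V} {c : ℕ∞} (hM : v ∉ M) (hB : v ∉ B)
    (h : ∀ w, w ∉ M → w ∉ B → mbVal E true M (insert w B) ≤ c) :
    mbVal E false M B ≤ c := by
  rw [mbVal]
  split_ifs with h₁ h₂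
  · exact zero_le
  · have : v ∈ Finset.univ \ (M ∪ B) := by simp [hM, hB]
    simp [h₂] at this
  · refine iSup₂_le fun w hw => ?_
    simp only [Finset.mem_sdiff, Finset.mem_univ, Finset.mem_union, true_and, not_or] at hw
    exact h w hw.1 hw.2

/-- A family of positions, monotone in Breaker's vertices, which Breaker can maintain for `K` more
moves of Maker shows that Maker needs more than `K` moves. -/
theorem lt_mbVal_of_invariant (P : ℕ → Finset V → Finset V → Prop)
    (mono : ∀ K M B B', B ⊆ B' → P K M B → P K M B')
    (safe : ∀ K M B, P K M B → ∀ e ∈ E, ¬ e ⊆ M)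
    (step : ∀ K M B v, P (K + 1) M B → v ∉ M → v ∉ B →
      ∃ w, w ∉ insert v M ∧ P K (insert v M) (insert w B)) :
    ∀ K M B, P K M B → ((K + 1 : ℕ) : ℕ∞) ≤ mbVal E true M B := by
  intro K
  induction K with
  | zero =>
    intro M B h
    rw [mbVal, if_neg (by simpa using safe _ _ _ h)]
    refine le_iInf₂ fun v _ => ?_
    simp
  | succ K ih =>
    intro M B h
    rw [mbVal, if_neg (by simpa using safe _ _ _ h)]
    refine le_iInf₂ fun v hv => ?_
    simp only [Finset.mem_sdiff, Finset.mem_univ, Finset.mem_union, true_and, not_or] at hv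
    obtain ⟨w, hw, hP⟩ := step K M B v h hv.1 hv.2
    have key : ((K + 1 : ℕ) : ℕ∞) ≤ mbVal E false (insert v M) B := by
      rw [mbVal, if_neg (by simpa using safe _ _ _ hP)]
      split_ifs with hfree
      · exact le_top
      by_cases hwB : w ∈ B
      · obtain ⟨w', hw'⟩ := Finset.nonempty_iff_ne_empty.mpr hfree
        exact (ih _ _ (mono _ _ _ _ (by grind) hP)).trans
          (le_iSup₂ (f := fun v' _ => mbVal E true (insert v M) (insert v' B)) w' hw')
      · exact (ih _ _ hP).trans
          (le_iSup₂ (f := fun v' _ => mbVal E true (insert v M) (insert v' B)) w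
            (by simp only [Finset.mem_sdiff, Finset.mem_univ, Finset.mem_union, true_and, not_or]
                exact ⟨hw, hwB⟩))
    push_cast at key ⊢
    rw [add_comm]
    gcongr

/-- Maker wins by bisection on a sequence of vertices `c 1, …, c (2 * T - 1)` in which every
`{c (p - 1), c p, c (p + 1)}` with `p` odd contains a hyperedge. -/
theorem mbVal_le_of_path {T : ℕ} {c : ℕ → V}
    (inj : ∀ p q, 1 ≤ p → p < 2 * T → 1 ≤ q → q < 2 * T → c p = c q → p = q)
    (edge : ∀ s, s < T → ∃ e ∈ E, ∀ v ∈ e, v = c (2 * s + 1) ∨ (1 ≤ s ∧ v = c (2 * s)) ∨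
      (s + 1 < T ∧ v = c (2 * s + 2))) (k : ℕ) :
    ∀ l r (M B : Finset V), l < r → r ≤ T → (l = 0 ∨ c (2 * l) ∈ M) → (r = T ∨ c (2 * r) ∈ M) →
      (∀ p, 2 * l < p → p < 2 * r → c p ∉ M ∧ c p ∉ B) → r - l ≤ 2 ^ k →
      mbVal E true M B ≤ (k + 1 : ℕ) := by
  have win : ∀ k l (M B : Finset V), l < T → (l = 0 ∨ c (2 * l) ∈ M) →
      (l + 1 = T ∨ c (2 * (l + 1)) ∈ M) → c (2 * l + 1) ∉ M → c (2 * l + 1) ∉ B →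
      mbVal E true M B ≤ (k + 1 : ℕ) := by
    intro k l M B hlT hl hr hM hB
    refine (mbVal_true_le hM hB).trans ?_
    rw [mbVal_false_eq_zero]
    · push_cast
      simp
    · obtain ⟨e, he, h⟩ := edge l hlT
      refine ⟨e, he, fun v hv => ?_⟩
      rw [Finset.mem_insert]
      rcases h v hv with rfl | ⟨h1, rfl⟩ | ⟨h1, rfl⟩
      · exact Or.inl rfl
      · exact Or.inr (hl.resolve_left (by omega))
      · exact Or.inr (hr.resolve_left (by omega))
  induction k with
  | zero =>
    intro l r M B hlr hrT hl hr hfree hk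
    obtain rfl : r = l + 1 := by simp at hk; omega
    obtain ⟨h1, h2⟩ := hfree (2 * l + 1) (by omega) (by omega)
    exact win _ l M B (by omega) hl hr h1 h2
  | succ k ih =>
    intro l r M B hlr hrT hl hr hfree hk
    obtain rfl | hlr' : r = l + 1 ∨ l + 1 < r := by omega
    · obtain ⟨h1, h2⟩ := hfree (2 * l + 1) (by omega) (by omega)
      exact win _ l M B (by omega) hl hr h1 h2
    obtain ⟨m, hlm, hmr, hm1, hm2⟩ : ∃ m, l < m ∧ m < r ∧ m - l ≤ 2 ^ k ∧ r - m ≤ 2 ^ k := by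
      rw [pow_succ] at hk
      exact ⟨(l + r) / 2, by omega, by omega, by omega, by omega⟩
    obtain ⟨hm3, hm4⟩ := hfree (2 * m) (by omega) (by omega)
    refine (mbVal_true_le hm3 hm4).trans ?_
    have : mbVal E false (insert (c (2 * m)) M) B ≤ (k + 1 : ℕ) := by
      have free : ∀ p, 2 * l < p → p < 2 * r → p ≠ 2 * m →
          c p ∉ insert (c (2 * m)) M ∧ c p ∉ B := by
        intro p h1 h2 h3
        refine ⟨?_, (hfree p h1 h2).2⟩
        rw [Finset.mem_insert, not_or]
        exact ⟨fun h => h3 (inj _ _ (by omega) (by omega) (by omega) (by omega) h),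
          (hfree p h1 h2).1⟩
      obtain ⟨h1, h2⟩ := free (2 * l + 1) (by omega) (by omega) (by omega)
      refine mbVal_false_le h1 h2 fun w _ _ => ?_
      by_cases hw : ∃ p, 2 * l < p ∧ p < 2 * m ∧ c p = w
      · obtain ⟨p, hp1, hp2, rfl⟩ := hw
        refine ih m r _ _ hmr hrT (Or.inr (by simp)) (hr.imp_right (by simp +contextual)) ?_ hm2
        intro q hq1 hq2
        obtain ⟨h3, h4⟩ := free q (by omega) hq2 (by omega)
        refine ⟨h3, ?_⟩
        rw [Finset.mem_insert, not_or]
        refine ⟨fun h => ?_, h4⟩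
        have := inj _ _ (by omega) (by omega) (by omega) (by omega) h
        omega
      · refine ih l m _ _ hlm (by omega) (hl.imp_right (by simp +contextual)) (Or.inr (by simp))
          ?_ hm1
        intro q hq1 hq2
        obtain ⟨h3, h4⟩ := free q hq1 (by omega) (by omega)
        refine ⟨h3, ?_⟩
        rw [Finset.mem_insert, not_or]
        exact ⟨fun h => hw ⟨q, hq1, hq2, h⟩, h4⟩
    calc 1 + mbVal E false (insert (c (2 * m)) M) B ≤ 1 + (k + 1 : ℕ) := by gcongr
      _ = (k + 1 + 1 : ℕ) := by push_cast; ring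

end Game

section Forest

open SimpleGraph

variable {W : Type} {H : SimpleGraph W} {Vt : Set W}

theorem reachable_deleteEdges_or {R : SimpleGraph W} {z r : W} (u y : W) (h : R.Reachable z r) :
    (R.deleteEdges {s(u, y)}).Reachable z r ∨ (R.deleteEdges {s(u, y)}).Reachable z u ∨
      (R.deleteEdges {s(u, y)}).Reachable z y := by
  obtain ⟨p⟩ := h
  induction p with
  | nil => exact Or.inl (Reachable.refl _)
  | @cons a b w hab p ih =>
    by_cases he : s(a, b) = s(u, y)
    · rcases Sym2.eq_iff.mp he with ⟨rfl, rfl⟩ | ⟨rfl, rfl⟩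
      · exact Or.inr (Or.inl (Reachable.refl _))
      · exact Or.inr (Or.inr (Reachable.refl _))
    · have hadj : (R.deleteEdges {s(u, y)}).Adj a b := deleteEdges_adj.mpr ⟨hab, he⟩
      exact ih.imp hadj.reachable.trans (Or.imp hadj.reachable.trans hadj.reachable.trans)

theorem exists_adj_reachable_deleteEdges {R : SimpleGraph W} {u w : W} (p : R.Walk u w)
    (hp : p.IsPath) (huw : u ≠ w) :
    ∃ y, R.Adj u y ∧ ∀ e, u ∈ e → (R.deleteEdges {e}).Reachable y w := by
  cases p with
  | nil => exact absurd rfl huw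
  | @cons _ y _ h q =>
    rw [Walk.cons_isPath_iff] at hp
    exact ⟨y, h, fun e hu => ⟨q.toDeleteEdge _ fun he =>
      hp.2 (q.mem_support_of_mem_edges he hu)⟩⟩

/-- The edges of `H` not yet claimed when the set of claimed nodes and edges is `C`. -/
def residualGraph (H : SimpleGraph W) (C : Set (W ⊕ Sym2 W)) : SimpleGraph W :=
  H.deleteEdges {e | Sum.inr e ∈ C}

/-- Two players claim nodes and edges of the forest `H`. Maker, whose elements are `M`, tries to
claim an edge with its ends or a node outside `Vt` with its edges. Breaker, whose elements are `B`,
survives `K` more moves of Maker if unclaimed edges connect every node to a claimed one and the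
nodes of Maker are pairwise far apart. -/
structure BreakerHolds (H : SimpleGraph W) (Vt : Set W) (K : ℕ) (M B : Set (W ⊕ Sym2 W)) : Prop where
  disj : ∀ x ∈ M, x ∉ B
  sub : ∀ e, Sum.inr e ∈ B → e ∈ H.edgeSet
  edge_guard : ∀ e, Sum.inr e ∈ M → ∃ u ∈ e, Sum.inl u ∈ B
  node_guard : ∀ w ∉ Vt, Sum.inl w ∈ M → ∃ e, w ∈ e ∧ Sum.inr e ∈ B
  rooted : ∀ z, ∃ r, Sum.inl r ∈ M ∪ B ∧ (residualGraph H (M ∪ B)).Reachable z r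
  far : ∀ w w' (p : (residualGraph H (M ∪ B)).Walk w w'), w ≠ w' → Sum.inl w ∈ M → Sum.inl w' ∈ M →
    2 ^ K < 2 * p.length

theorem residualGraph_eq_deleteEdges {C : Set (W ⊕ Sym2 W)} (e : Sym2 W) {D : Set (W ⊕ Sym2 W)}
    (hD : ∀ f, Sum.inr f ∈ D ↔ f = e ∨ Sum.inr f ∈ C) :
    residualGraph H D = (residualGraph H C).deleteEdges {e} := by
  rw [residualGraph, residualGraph, deleteEdges_deleteEdges]
  congr 1
  ext f
  simp [hD]

theorem BreakerHolds.node_step (hH : H.IsAcyclic) {K : ℕ} {M B : Set (W ⊕ Sym2 W)}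
    (h : BreakerHolds H Vt (K + 1) M B) {u : W} (huM : Sum.inl u ∉ M) (huB : Sum.inl u ∉ B) :
    ∃ e ∈ H.edgeSet, Sum.inr e ∉ M ∧
      BreakerHolds H Vt K (insert (Sum.inl u) M) (insert (Sum.inr e) B) := by
  obtain ⟨y, r, hr, hadj, hyr, hfar⟩ : ∃ y r, Sum.inl r ∈ M ∪ B ∧
      (residualGraph H (M ∪ B)).Adj u y ∧
      ((residualGraph H (M ∪ B)).deleteEdges {s(u, y)}).Reachable y r ∧
      ∀ w, Sum.inl w ∈ M → ∀ q : ((residualGraph H (M ∪ B)).deleteEdges {s(u, y)}).Walk u w,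
        2 ^ K < 2 * q.length := by
    by_cases hreach : ∃ n, ∃ w, Sum.inl w ∈ M ∧
        ∃ p : (residualGraph H (M ∪ B)).Walk u w, p.length = n
    · obtain ⟨w, hw, p, hp⟩ := Nat.find_spec hreach
      have hmin : ∀ w', Sum.inl w' ∈ M → ∀ q : (residualGraph H (M ∪ B)).Walk u w',
          p.length ≤ q.length := fun w' hw' q => by
        rw [hp]
        exact Nat.find_min' hreach ⟨w', hw', q, rfl⟩
      obtain ⟨y, hadj, hy⟩ := exists_adj_reachable_deleteEdges p.bypass p.bypass_isPath
        (by rintro rfl; exact huM hw)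
      replace hy := hy s(u, y) (Sym2.mem_mk_left _ _)
      refine ⟨y, w, Or.inl hw, hadj, hy, fun w' hw' q => ?_⟩
      have hle := deleteEdges_le (G := residualGraph H (M ∪ B)) {s(u, y)}
      have hww' : w ≠ w' := by
        rintro rfl
        have hHu : H.Adj u y := (deleteEdges_adj.mp hadj).1
        refine isBridge_iff.mp (isAcyclic_iff_forall_adj_isBridge.mp hH hHu) ?_
        refine (q.reachable.trans hy.symm).mono ?_
        intro a b hab
        rw [deleteEdges_adj] at hab ⊢
        exact ⟨(deleteEdges_adj.mp hab.1).1, hab.2⟩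
      have h1 := h.far w w' (p.reverse.append (q.mapLe hle)) hww' hw hw'
      have h2 := hmin w' hw' (q.mapLe hle)
      rw [Walk.length_append, Walk.length_reverse, Walk.length_mapLe, pow_succ] at h1
      rw [Walk.length_mapLe] at h2
      omega
    · obtain ⟨r, hr, ⟨p⟩⟩ := h.rooted u
      obtain ⟨y, hadj, hy⟩ := exists_adj_reachable_deleteEdges p.bypass p.bypass_isPath
        (by rintro rfl; exact hr.elim huM huB)
      refine ⟨y, r, hr, hadj, hy s(u, y) (Sym2.mem_mk_left _ _), fun w hw q => absurd ?_ hreach⟩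
      exact ⟨_, w, hw, q.mapLe (deleteEdges_le _), rfl⟩
  obtain ⟨hHuy, hnew⟩ := deleteEdges_adj.mp hadj
  have hnew' : Sum.inr s(u, y) ∉ M ∧ Sum.inr s(u, y) ∉ B := by
    simpa using hnew
  have hres : residualGraph H (insert (Sum.inl u) M ∪ insert (Sum.inr s(u, y)) B) =
      (residualGraph H (M ∪ B)).deleteEdges {s(u, y)} :=
    residualGraph_eq_deleteEdges _ fun f => by simp
  refine ⟨s(u, y), hHuy, hnew'.1, ?_, ?_, ?_, ?_, ?_, ?_⟩
  · rintro x (rfl | hx) (h1 | hB)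
    · simp at h1
    · exact huB hB
    · exact hnew'.1 (h1 ▸ hx)
    · exact h.disj x hx hB
  · rintro e (he | he)
    · rw [Sum.inr.inj he]
      exact hHuy
    · exact h.sub e he
  · rintro e (he | he)
    · simp at he
    · obtain ⟨v, hv, hvB⟩ := h.edge_guard e he
      exact ⟨v, hv, Or.inr hvB⟩
  · rintro w hw (he | he)
    · rw [Sum.inl.inj he]
      exact ⟨s(u, y), by simp, Or.inl rfl⟩
    · obtain ⟨e, hwe, heB⟩ := h.node_guard w hw he
      exact ⟨e, hwe, Or.inr heB⟩
  · intro z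
    rw [hres]
    have hmem : ∀ {v : W}, Sum.inl v ∈ M ∪ B →
        Sum.inl v ∈ insert (Sum.inl u) M ∪ insert (Sum.inr s(u, y)) B :=
      fun hv => hv.imp Or.inr Or.inr
    obtain ⟨r', hr', hz⟩ := h.rooted z
    rcases reachable_deleteEdges_or u y hz with hz | hz | hz
    · exact ⟨r', hmem hr', hz⟩
    · exact ⟨u, Or.inl (Or.inl rfl), hz⟩
    · exact ⟨r, hmem hr, hz.trans hyr⟩
  · rw [hres]
    rintro w w' p hww' (hw | hw) (hw' | hw')
    · exact absurd (Sum.inl.inj (hw.trans hw'.symm)) hww'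
    · obtain rfl := Sum.inl.inj hw
      exact hfar w' hw' p
    · obtain rfl := Sum.inl.inj hw'
      simpa using hfar w hw p.reverse
    · have h1 := h.far w w' (p.mapLe (deleteEdges_le _)) hww' hw hw'
      rw [Walk.length_mapLe, pow_succ] at h1
      omega

theorem BreakerHolds.edge_step {K : ℕ} {M B : Set (W ⊕ Sym2 W)} (h : BreakerHolds H Vt (K + 1) M B)
    {e : Sym2 W} (heH : e ∈ H.edgeSet) (heM : Sum.inr e ∉ M) (heB : Sum.inr e ∉ B) :
    ∃ u, Sum.inl u ∉ M ∧ BreakerHolds H Vt K (insert (Sum.inr e) M) (insert (Sum.inl u) B) := by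
  induction e with | h a b => ?_
  have hadj : (residualGraph H (M ∪ B)).Adj a b :=
    deleteEdges_adj.mpr ⟨heH, by simp [heM, heB]⟩
  obtain ⟨u, hu, huM, hroot⟩ : ∃ u ∈ s(a, b), Sum.inl u ∉ M ∧ ∀ v ∈ s(a, b), ∃ r,
      (r = u ∨ Sum.inl r ∈ M ∪ B) ∧
        ((residualGraph H (M ∪ B)).deleteEdges {s(a, b)}).Reachable v r := by
    by_cases hall : ∀ v ∈ s(a, b), ∃ r, Sum.inl r ∈ M ∪ B ∧
        ((residualGraph H (M ∪ B)).deleteEdges {s(a, b)}).Reachable v r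
    · have : ∃ u ∈ s(a, b), Sum.inl u ∉ M := by
        by_contra! hcon
        have h1 := h.far a b hadj.toWalk hadj.ne (hcon a (by simp)) (hcon b (by simp))
        have := Nat.one_le_two_pow (n := K)
        rw [pow_succ] at h1
        simp at h1
        omega
      obtain ⟨u, hu, huM⟩ := this
      exact ⟨u, hu, huM, fun v hv => (hall v hv).imp fun r hr => ⟨Or.inr hr.1, hr.2⟩⟩
    · push Not at hall
      obtain ⟨u, hu, hno⟩ := hall
      refine ⟨u, hu, fun huM => hno u (Or.inl huM) (Reachable.refl _), fun v hv => ?_⟩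
      by_cases hvu : v = u
      · exact ⟨u, Or.inl rfl, hvu ▸ Reachable.refl _⟩
      obtain ⟨r, hr, hur⟩ := h.rooted u
      have hv' : ((residualGraph H (M ∪ B)).deleteEdges {s(a, b)}).Reachable v r := by
        have huv : s(a, b) = s(u, v) := ((Sym2.mem_and_mem_iff (Ne.symm hvu)).mp ⟨hu, hv⟩)
        rw [huv] at hno ⊢
        obtain ⟨p⟩ := hur
        obtain ⟨y, hy, hyr⟩ := exists_adj_reachable_deleteEdges p.bypass p.bypass_isPath
          (by rintro rfl; exact hno u hr (Reachable.refl _))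
        obtain rfl | hyv := eq_or_ne y v
        · exact hyr _ (Sym2.mem_mk_left _ _)
        · have hadj' : ((residualGraph H (M ∪ B)).deleteEdges {s(u, v)}).Adj u y :=
            deleteEdges_adj.mpr ⟨hy, fun h => hyv (Sym2.congr_right.mp h)⟩
          exact absurd (hadj'.reachable.trans (hyr _ (Sym2.mem_mk_left _ _))) (hno r hr)
      exact ⟨r, Or.inr hr, hv'⟩
  have hres : residualGraph H (insert (Sum.inr s(a, b)) M ∪ insert (Sum.inl u) B) =
      (residualGraph H (M ∪ B)).deleteEdges {s(a, b)} :=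
    residualGraph_eq_deleteEdges _ fun f => by simp; tauto
  refine ⟨u, huM, ?_, ?_, ?_, ?_, ?_, ?_⟩
  · rintro x (rfl | hx) (h1 | hB)
    · simp at h1
    · exact heB hB
    · exact huM (h1 ▸ hx)
    · exact h.disj x hx hB
  · rintro e (he | he)
    · simp at he
    · exact h.sub e he
  · rintro e (he | he)
    · rw [Sum.inr.inj he]
      exact ⟨u, hu, Or.inl rfl⟩
    · obtain ⟨v, hv, hvB⟩ := h.edge_guard e he
      exact ⟨v, hv, Or.inr hvB⟩
  · rintro w hw (he | he)
    · simp at he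
    · obtain ⟨e, hwe, heB⟩ := h.node_guard w hw he
      exact ⟨e, hwe, Or.inr heB⟩
  · intro z
    rw [hres]
    have hmem : ∀ {v : W}, v = u ∨ Sum.inl v ∈ M ∪ B →
        Sum.inl v ∈ insert (Sum.inr s(a, b)) M ∪ insert (Sum.inl u) B := by
      rintro v (rfl | hv)
      · exact Or.inr (Or.inl rfl)
      · exact hv.imp Or.inr Or.inr
    obtain ⟨r', hr', hz⟩ := h.rooted z
    rcases reachable_deleteEdges_or a b hz with hz | hz | hz
    · exact ⟨r', hmem (Or.inr hr'), hz⟩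
    · obtain ⟨r, hr, har⟩ := hroot a (by simp)
      exact ⟨r, hmem hr, hz.trans har⟩
    · obtain ⟨r, hr, har⟩ := hroot b (by simp)
      exact ⟨r, hmem hr, hz.trans har⟩
  · rw [hres]
    rintro w w' p hww' (hw | hw) (hw' | hw')
    · simp at hw
    · simp at hw
    · simp at hw'
    · have h1 := h.far w w' (p.mapLe (deleteEdges_le _)) hww' hw hw'
      rw [Walk.length_mapLe, pow_succ] at h1
      omega

end Forest

/-- If the vertices of `G` are the nodes outside `Vt` and the edges of a forest, adjacent when
incident, then Breaker's position on the forest gives a lower bound for `γ'_SMB`. -/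
theorem BreakerHolds.lt_gammaSMB' {V W : Type} [Fintype V] {G : SimpleGraph V}
    {H : SimpleGraph W} {Vt : Set W} (hH : H.IsAcyclic) (φ : V → W ⊕ Sym2 W)
    (inj : Function.Injective φ)
    (node_notMem : ∀ v w, φ v = Sum.inl w → w ∉ Vt)
    (edge_mem : ∀ v e, φ v = Sum.inr e → e ∈ H.edgeSet)
    (node_surj : ∀ w ∉ Vt, ∃ v, φ v = Sum.inl w)
    (edge_surj : ∀ e ∈ H.edgeSet, ∃ v, φ v = Sum.inr e)
    (adj : ∀ v v' w e, φ v = Sum.inl w → φ v' = Sum.inr e → w ∈ e → G.Adj v v')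
    {K : ℕ} (h : BreakerHolds H Vt K (Sum.inl '' Vt) ∅) :
    ((K + 1 : ℕ) : ℕ∞) ≤ gammaSMB' G := by
  refine lt_mbVal_of_invariant (fun K M B => ∃ B' : Set (W ⊕ Sym2 W),
    (∀ x ∈ B', ∃ v ∈ B, φ v = x) ∧ BreakerHolds H Vt K (Sum.inl '' Vt ∪ φ '' (M : Set V)) B')
    ?_ ?_ ?_ K ∅ ∅ ⟨∅, by simp, by simpa using h⟩
  · rintro K M B B₁ hB ⟨B', hB', hP⟩
    exact ⟨B', fun x hx => (hB' x hx).imp fun v hv => ⟨hB hv.1, hv.2⟩, hP⟩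
  · rintro K M B ⟨B', hB', hP⟩ _ ⟨v, rfl⟩ hsub
    have hmem : ∀ v', v' = v ∨ G.Adj v v' → φ v' ∉ B' := fun v' hv' =>
      hP.disj _ (Or.inr ⟨v', hsub (by simpa [closedNbhdFinset] using hv'), rfl⟩)
    have hv : φ v ∈ Sum.inl '' Vt ∪ φ '' (M : Set V) :=
      Or.inr ⟨v, hsub (by simp [closedNbhdFinset]), rfl⟩
    rcases hφ : φ v with w | e
    · obtain ⟨e, hwe, he⟩ := hP.node_guard w (node_notMem v w hφ) (hφ ▸ hv)
      obtain ⟨v', -, hv'⟩ := hB' _ he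
      exact hmem v' (Or.inr (adj v v' w e hφ hv' hwe)) (hv' ▸ he)
    · obtain ⟨u, hue, hu⟩ := hP.edge_guard e (hφ ▸ hv)
      obtain ⟨v', -, hv'⟩ := hB' _ hu
      exact hmem v' (Or.inr (adj v' v u e hv' hφ hue).symm) (hv' ▸ hu)
  · rintro K M B v ⟨B', hB', hP⟩ hvM hvB
    have hM : φ v ∉ Sum.inl '' Vt ∪ φ '' (M : Set V) := by
      rintro (⟨w, hw, hwv⟩ | ⟨v', hv', hvv⟩)
      · exact node_notMem v w hwv.symm hw
      · exact hvM (inj hvv ▸ hv')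
    have hB : φ v ∉ B' := fun hx => by
      obtain ⟨v', hv', hvv⟩ := hB' _ hx
      exact hvB (inj hvv ▸ hv')
    have hins : Sum.inl '' Vt ∪ φ '' ((insert v M : Finset V) : Set V) =
        insert (φ v) (Sum.inl '' Vt ∪ φ '' (M : Set V)) := by
      rw [Finset.coe_insert, Set.image_insert_eq, Set.union_insert]
    have finish : ∀ x, (∃ w, φ w = x) → x ∉ insert (φ v) (Sum.inl '' Vt ∪ φ '' (M : Set V)) →
        BreakerHolds H Vt K (insert (φ v) (Sum.inl '' Vt ∪ φ '' (M : Set V))) (insert x B') →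
        ∃ w, w ∉ insert v M ∧ ∃ B₁ : Set (W ⊕ Sym2 W), (∀ x ∈ B₁, ∃ v ∈ insert w B, φ v = x) ∧
          BreakerHolds H Vt K (Sum.inl '' Vt ∪ φ '' ((insert v M : Finset V) : Set V)) B₁ := by
      rintro _ ⟨w, rfl⟩ hx hP'
      refine ⟨w, fun hw => hx ?_, insert (φ w) B', ?_, hins ▸ hP'⟩
      · rw [← hins]
        exact Or.inr ⟨w, hw, rfl⟩
      · rintro x (rfl | hx)
        · exact ⟨w, by simp, rfl⟩
        · obtain ⟨v', hv', rfl⟩ := hB' x hx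
          exact ⟨v', by simp [hv'], rfl⟩
    rcases hφ : φ v with u | e
    · rw [hφ] at hM hB finish
      obtain ⟨e, he, heM, hP'⟩ := hP.node_step hH hM hB
      exact finish _ (edge_surj e he) (by simpa using heM) hP'
    · rw [hφ] at hM hB finish
      obtain ⟨u, huM, hP'⟩ := hP.edge_step (edge_mem v e hφ) hM hB
      exact finish _ (node_surj u fun hu => huM (Or.inl ⟨u, hu, rfl⟩)) (by simpa using huM) hP'

section Spider

open SimpleGraph

variable {ℓ : ℕ} {n : ℕ → ℕ}

/-- The node preceding the node `some (i, k)` on the way to the center `none` of a spider. -/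
def spiderPrev (i : Fin ℓ) : ℕ → Option (Fin ℓ × ℕ)
  | 0 => none
  | k + 1 => some (i, k)

/-- The spider whose edges and nodes, except for the last node of each odd branch, are the vertices
of `subdividedStar ℓ n`; the remaining nodes of the type are isolated. -/
def spider (ℓ : ℕ) (n : ℕ → ℕ) : SimpleGraph (Option (Fin ℓ × ℕ)) :=
  SimpleGraph.fromRel fun x y => ∃ (i : Fin ℓ) (k : ℕ),
    2 * k < n i ∧ x = spiderPrev i k ∧ y = some (i, k)

/-- The nodes of the spider which are not vertices of `subdividedStar ℓ n`. -/
def spiderEnds (ℓ : ℕ) (n : ℕ → ℕ) : Set (Option (Fin ℓ × ℕ)) :=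
  {w | ∃ (i : Fin ℓ) (k : ℕ), n i ≤ 2 * k + 1 ∧ w = some (i, k)}

/-- The node or edge of the spider corresponding to a vertex of `subdividedStar ℓ n`. -/
def starToSpider (ℓ : ℕ) (n : ℕ → ℕ) :
    Option (Σ i : Fin ℓ, Fin (n i)) → Option (Fin ℓ × ℕ) ⊕ Sym2 (Option (Fin ℓ × ℕ))
  | none => Sum.inl none
  | some ⟨i, j⟩ =>
      if (j : ℕ) % 2 = 1 then Sum.inl (some (i, (j : ℕ) / 2))
      else Sum.inr s(spiderPrev i ((j : ℕ) / 2), some (i, (j : ℕ) / 2))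

theorem spiderPrev_eq_some {i i' : Fin ℓ} {k k' : ℕ} :
    spiderPrev i k = some (i', k') ↔ i = i' ∧ k = k' + 1 := by
  cases k <;> simp [spiderPrev]

theorem spiderPrev_eq_none {i : Fin ℓ} {k : ℕ} : spiderPrev i k = none ↔ k = 0 := by
  cases k <;> simp [spiderPrev]

theorem spider_adj_prev {i : Fin ℓ} {k : ℕ} (h : 2 * k < n i) :
    (spider ℓ n).Adj (spiderPrev i k) (some (i, k)) := by
  rw [spider, fromRel_adj]
  exact ⟨fun h => by simp [spiderPrev_eq_some] at h, Or.inl ⟨i, k, h, rfl, rfl⟩⟩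

theorem spider_mem_edgeSet {e : Sym2 (Option (Fin ℓ × ℕ))} :
    e ∈ (spider ℓ n).edgeSet ↔
      ∃ (i : Fin ℓ) (k : ℕ), 2 * k < n i ∧ e = s(spiderPrev i k, some (i, k)) := by
  constructor
  · induction e with | h x y => ?_
    rw [mem_edgeSet, spider, fromRel_adj]
    rintro ⟨-, ⟨i, k, h, rfl, rfl⟩ | ⟨i, k, h, rfl, rfl⟩⟩
    · exact ⟨i, k, h, rfl⟩
    · exact ⟨i, k, h, Sym2.eq_swap⟩
  · rintro ⟨i, k, h, rfl⟩
    exact spider_adj_prev h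

theorem spider_edge_inj {i i' : Fin ℓ} {k k' : ℕ}
    (h : s(spiderPrev i k, some (i, k)) = s(spiderPrev i' k', some (i', k'))) :
    i = i' ∧ k = k' := by
  rcases Sym2.eq_iff.mp h with ⟨-, h2⟩ | ⟨h1, h2⟩
  · simpa using h2
  · rw [spiderPrev_eq_some] at h1
    have := spiderPrev_eq_some.mp h2.symm
    omega

theorem spider_isAcyclic : (spider ℓ n).IsAcyclic := by
  rw [isAcyclic_iff_forall_isBridge]
  intro e he
  obtain ⟨i, k, hk, rfl⟩ := spider_mem_edgeSet.mp he
  rw [isBridge_iff]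
  rintro ⟨p⟩
  have inv : ∀ (x y : Option (Fin ℓ × ℕ))
      (q : ((spider ℓ n).deleteEdges {s(spiderPrev i k, some (i, k))}).Walk x y),
      (∃ k', k ≤ k' ∧ x = some (i, k')) ↔ ∃ k', k ≤ k' ∧ y = some (i, k') := by
    intro x y q
    induction q with
    | nil => rfl
    | @cons x y z hxy q ih =>
      rw [← ih]
      obtain ⟨h1, h2⟩ := deleteEdges_adj.mp hxy
      obtain ⟨i', k', hk', h3⟩ := spider_mem_edgeSet.mp ((mem_edgeSet _).mpr h1)
      have key : (∃ m, k ≤ m ∧ spiderPrev i' k' = some (i, m)) ↔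
          ∃ m, k ≤ m ∧ some (i', k') = some (i, m) := by
        simp only [spiderPrev_eq_some, Option.some.injEq, Prod.mk.injEq]
        constructor
        · rintro ⟨m, hm, rfl, rfl⟩
          exact ⟨_, by omega, rfl, rfl⟩
        · rintro ⟨m, hm, rfl, rfl⟩
          have : k' ≠ k := by
            rintro rfl
            exact h2 h3
          exact ⟨k' - 1, by omega, rfl, by omega⟩
      rcases Sym2.eq_iff.mp h3 with ⟨rfl, rfl⟩ | ⟨rfl, rfl⟩
      · exact key
      · exact key.symm
  obtain ⟨k', hk', h⟩ := (inv _ _ p).mpr ⟨k, le_rfl, rfl⟩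
  rw [spiderPrev_eq_some] at h
  omega

/-- The distance to the center, counted negatively outside the branch `i`. -/
def spiderDepth (i : Fin ℓ) : Option (Fin ℓ × ℕ) → ℤ
  | none => 0
  | some (i', k) => if i' = i then k + 1 else -(k + 1)

theorem spiderDepth_sub_le (i : Fin ℓ) {x y : Option (Fin ℓ × ℕ)} (p : (spider ℓ n).Walk x y) :
    spiderDepth i x - spiderDepth i y ≤ p.length := by
  induction p with
  | nil => simp
  | @cons x y z hxy q ih =>
    obtain ⟨i', k', hk', h3⟩ := spider_mem_edgeSet.mp ((mem_edgeSet _).mpr hxy)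
    have key : |spiderDepth i (spiderPrev i' k') - spiderDepth i (some (i', k'))| ≤ 1 := by
      cases k' <;> simp only [spiderPrev, spiderDepth] <;> split_ifs <;> push_cast <;>
        rw [abs_le] <;> constructor <;> omega
    rw [abs_le] at key
    rw [Walk.length_cons]
    push_cast
    rcases Sym2.eq_iff.mp h3 with ⟨rfl, rfl⟩ | ⟨rfl, rfl⟩ <;> omega

theorem lt_of_spider_adj {i : Fin ℓ} {k : ℕ} {y : Option (Fin ℓ × ℕ)}
    (h : (spider ℓ n).Adj (some (i, k)) y) : 2 * k < n i := by
  obtain ⟨i', k', hk', h3⟩ := spider_mem_edgeSet.mp ((mem_edgeSet _).mpr h)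
  rcases Sym2.eq_iff.mp h3 with ⟨h1, -⟩ | ⟨h1, -⟩
  · obtain ⟨rfl, rfl⟩ := spiderPrev_eq_some.mp h1.symm
    omega
  · simp only [Option.some.injEq, Prod.mk.injEq] at h1
    obtain ⟨rfl, rfl⟩ := h1
    exact hk'

theorem lt_of_spider_walk {i : Fin ℓ} {k : ℕ} {y : Option (Fin ℓ × ℕ)}
    (p : (spider ℓ n).Walk (some (i, k)) y) (hy : some (i, k) ≠ y) : 2 * k < n i := by
  cases p with
  | nil => exact absurd rfl hy
  | cons h _ => exact lt_of_spider_adj h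

theorem spider_breakerHolds {K : ℕ} (a : Fin ℓ) (hoa : Odd (n a))
    (hK : ∀ i j : Fin ℓ, i ≠ j → Odd (n i) → Odd (n j) → 2 ^ K < n i + n j + 2) :
    BreakerHolds (spider ℓ n) (spiderEnds ℓ n) K (Sum.inl '' spiderEnds ℓ n) ∅ := by
  have hres : residualGraph (spider ℓ n) (Sum.inl '' spiderEnds ℓ n ∪ ∅) = spider ℓ n := by
    simp [residualGraph]
  refine ⟨by simp, by simp, by simp, ?_, ?_, ?_⟩
  · rintro w hw ⟨w', hw', h⟩
    exact absurd (Sum.inl.inj h ▸ hw') hw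
  · rw [hres]
    have hnone : ∀ (i : Fin ℓ) (k : ℕ), 2 * k < n i →
        (spider ℓ n).Reachable none (some (i, k)) := by
      intro i k
      induction k with
      | zero => exact fun h => (spider_adj_prev h).reachable
      | succ k ih => exact fun h => (ih (by omega)).trans (spider_adj_prev h).reachable
    have hend : Sum.inl (some (a, n a / 2)) ∈
        (Sum.inl '' spiderEnds ℓ n ∪ ∅ : Set (_ ⊕ Sym2 (Option (Fin ℓ × ℕ)))) :=
      Or.inl ⟨_, ⟨a, n a / 2, by omega, rfl⟩, rfl⟩
    have hlt : 2 * (n a / 2) < n a := by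
      obtain ⟨m, hm⟩ := hoa
      omega
    rintro (_ | ⟨i, k⟩)
    · exact ⟨_, hend, hnone a _ hlt⟩
    · by_cases hk : 2 * k < n i
      · exact ⟨_, hend, (hnone i k hk).symm.trans (hnone a _ hlt)⟩
      · exact ⟨_, Or.inl ⟨_, ⟨i, k, by omega, rfl⟩, rfl⟩, Reachable.refl _⟩
  · rw [hres]
    rintro w w' p hne ⟨_, ⟨i, k, hk, rfl⟩, h1⟩ ⟨_, ⟨j, m, hm, rfl⟩, h2⟩
    obtain rfl := Sum.inl.inj h1
    obtain rfl := Sum.inl.inj h2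
    have hk' := lt_of_spider_walk p hne
    have hm' := lt_of_spider_walk p.reverse hne.symm
    have hij : i ≠ j := by
      rintro rfl
      exact hne (by rw [show k = m by omega])
    have h3 := hK i j hij ⟨k, by omega⟩ ⟨m, by omega⟩
    have h4 := spiderDepth_sub_le i p
    simp only [spiderDepth, if_true, if_neg hij.symm] at h4
    omega

theorem some_branch_ext {i : Fin ℓ} {j j' : Fin (n i)} (h : (j : ℕ) = j') :
    (some ⟨i, j⟩ : Option (Σ i : Fin ℓ, Fin (n i))) = some ⟨i, j'⟩ := by
  rw [Fin.ext h]

theorem subdividedStar_adj_center {i : Fin ℓ} {j : Fin (n i)} (hj : (j : ℕ) = 0) :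
    (subdividedStar ℓ n).Adj none (some ⟨i, j⟩) := by
  rw [subdividedStar, fromRel_adj]
  exact ⟨by simp, Or.inl (Or.inl ⟨i, by omega, rfl, some_branch_ext hj⟩)⟩

theorem subdividedStar_adj_succ {i : Fin ℓ} {j j' : Fin (n i)} (hj : (j' : ℕ) = j + 1) :
    (subdividedStar ℓ n).Adj (some ⟨i, j⟩) (some ⟨i, j'⟩) := by
  rw [subdividedStar, fromRel_adj]
  refine ⟨fun h => ?_, Or.inl (Or.inr ⟨i, j, by omega, rfl, some_branch_ext hj⟩)⟩
  simp only [Option.some.injEq, Sigma.mk.injEq, heq_eq_eq, true_and] at h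
  rw [h] at hj
  omega

theorem subdividedStar_adj_cases {i : Fin ℓ} {j : Fin (n i)} {v : Option (Σ i : Fin ℓ, Fin (n i))}
    (h : (subdividedStar ℓ n).Adj (some ⟨i, j⟩) v) :
    ((j : ℕ) = 0 ∧ v = none) ∨
      ∃ j' : Fin (n i), v = some ⟨i, j'⟩ ∧ ((j' : ℕ) = j + 1 ∨ (j : ℕ) = j' + 1) := by
  rw [subdividedStar, fromRel_adj] at h
  rcases h with ⟨-, (⟨i', h, h1, -⟩ | ⟨i', j', h, h1, rfl⟩) | ⟨i', h, rfl, h1⟩ |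
    ⟨i', j', h, rfl, h1⟩⟩
  · simp at h1
  · cases h1
    exact Or.inr ⟨_, rfl, Or.inl rfl⟩
  · cases h1
    exact Or.inl ⟨rfl, rfl⟩
  · cases h1
    exact Or.inr ⟨_, rfl, Or.inr rfl⟩

theorem starToSpider_eq_inl_some {v : Option (Σ i : Fin ℓ, Fin (n i))} {i : Fin ℓ} {k : ℕ} :
    starToSpider ℓ n v = Sum.inl (some (i, k)) ↔
      ∃ h : 2 * k + 1 < n i, v = some ⟨i, ⟨2 * k + 1, h⟩⟩ := by
  constructor
  · rcases v with _ | ⟨i', j⟩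
    · simp [starToSpider]
    · simp only [starToSpider]
      split_ifs with hj
      · intro h
        simp only [Sum.inl.injEq, Option.some.injEq, Prod.mk.injEq] at h
        obtain ⟨rfl, rfl⟩ := h
        have hj' : 2 * ((j : ℕ) / 2) + 1 = j := by omega
        exact ⟨by omega, some_branch_ext hj'.symm⟩
      · simp
  · rintro ⟨h, rfl⟩
    simp only [starToSpider]
    rw [if_pos (by omega), show (2 * k + 1) / 2 = k by omega]

theorem starToSpider_eq_inl_none {v : Option (Σ i : Fin ℓ, Fin (n i))} :
    starToSpider ℓ n v = Sum.inl none ↔ v = none := by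
  rcases v with _ | ⟨i, j⟩
  · simp [starToSpider]
  · simp only [starToSpider]
    split_ifs <;> simp

theorem starToSpider_eq_inr {v : Option (Σ i : Fin ℓ, Fin (n i))}
    {e : Sym2 (Option (Fin ℓ × ℕ))} :
    starToSpider ℓ n v = Sum.inr e ↔ ∃ (i : Fin ℓ) (k : ℕ) (h : 2 * k < n i),
      v = some ⟨i, ⟨2 * k, h⟩⟩ ∧ e = s(spiderPrev i k, some (i, k)) := by
  constructor
  · rcases v with _ | ⟨i, j⟩
    · simp [starToSpider]
    · simp only [starToSpider]
      split_ifs with hj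
      · simp
      · intro h
        have hj' : 2 * ((j : ℕ) / 2) = j := by omega
        exact ⟨i, (j : ℕ) / 2, by omega, some_branch_ext hj'.symm, (Sum.inr.inj h).symm⟩
  · rintro ⟨i, k, h, rfl, rfl⟩
    simp only [starToSpider]
    rw [if_neg (by omega), show 2 * k / 2 = k by omega]

theorem starToSpider_injective : Function.Injective (starToSpider ℓ n) := by
  intro v v' h
  rcases hv' : starToSpider ℓ n v' with (_ | ⟨i, k⟩) | e <;> rw [hv'] at h
  · rw [starToSpider_eq_inl_none.mp h, starToSpider_eq_inl_none.mp hv']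
  · obtain ⟨_, rfl⟩ := starToSpider_eq_inl_some.mp h
    obtain ⟨_, rfl⟩ := starToSpider_eq_inl_some.mp hv'
    rfl
  · obtain ⟨i, k, _, rfl, he⟩ := starToSpider_eq_inr.mp h
    obtain ⟨i', k', _, rfl, he'⟩ := starToSpider_eq_inr.mp hv'
    obtain ⟨rfl, rfl⟩ := spider_edge_inj (he.symm.trans he')
    rfl

theorem subdividedStar_adj_of_incident {v v' : Option (Σ i : Fin ℓ, Fin (n i))}
    {w : Option (Fin ℓ × ℕ)} {e : Sym2 (Option (Fin ℓ × ℕ))}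
    (hv : starToSpider ℓ n v = Sum.inl w) (hv' : starToSpider ℓ n v' = Sum.inr e) (hwe : w ∈ e) :
    (subdividedStar ℓ n).Adj v v' := by
  obtain ⟨i, k, hk, rfl, rfl⟩ := starToSpider_eq_inr.mp hv'
  rw [Sym2.mem_iff] at hwe
  rcases w with _ | ⟨i', k'⟩
  · rw [starToSpider_eq_inl_none.mp hv]
    have hk0 : k = 0 := spiderPrev_eq_none.mp (hwe.resolve_right (by simp)).symm
    exact subdividedStar_adj_center (by simp [hk0])
  · obtain ⟨hk', rfl⟩ := starToSpider_eq_inl_some.mp hv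
    rcases hwe with h | h
    · obtain ⟨rfl, rfl⟩ := spiderPrev_eq_some.mp h.symm
      exact subdividedStar_adj_succ (by simp; ring)
    · simp only [Option.some.injEq, Prod.mk.injEq] at h
      obtain ⟨rfl, rfl⟩ := h
      exact (subdividedStar_adj_succ (by simp)).symm

theorem lt_gammaSMB'_subdividedStar {K : ℕ} (a : Fin ℓ) (hoa : Odd (n a))
    (hK : ∀ i j : Fin ℓ, i ≠ j → Odd (n i) → Odd (n j) → 2 ^ K < n i + n j + 2) :
    ((K + 1 : ℕ) : ℕ∞) ≤ gammaSMB' (subdividedStar ℓ n) := by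
  refine (spider_breakerHolds a hoa hK).lt_gammaSMB' spider_isAcyclic (starToSpider ℓ n)
    starToSpider_injective ?_ ?_ ?_ ?_ fun v v' w e => subdividedStar_adj_of_incident
  · rintro v w hv ⟨i, k, hk, rfl⟩
    obtain ⟨h, -⟩ := starToSpider_eq_inl_some.mp hv
    omega
  · intro v e hv
    obtain ⟨i, k, hk, -, he⟩ := starToSpider_eq_inr.mp hv
    exact spider_mem_edgeSet.mpr ⟨i, k, hk, he⟩
  · rintro (_ | ⟨i, k⟩) hw
    · exact ⟨none, rfl⟩
    · exact ⟨_, starToSpider_eq_inl_some.mpr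
        ⟨not_le.mp fun h => hw ⟨i, k, h, rfl⟩, rfl⟩⟩
  · intro e he
    obtain ⟨i, k, hk, rfl⟩ := spider_mem_edgeSet.mp he
    exact ⟨_, starToSpider_eq_inr.mpr ⟨i, k, hk, rfl, rfl⟩⟩

/-- The vertices, numbered from `1`, on the path from the leaf of the branch `a` through the center
to the leaf of the branch `b`. -/
def branchPath (n : ℕ → ℕ) (a b : Fin ℓ) (p : ℕ) : Option (Σ i : Fin ℓ, Fin (n i)) :=
  if h : 0 < p ∧ p ≤ n a then some ⟨a, ⟨n a - p, by omega⟩⟩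
  else if h : n a + 1 < p ∧ p < n a + n b + 2 then some ⟨b, ⟨p - n a - 2, by omega⟩⟩
  else none

theorem branchPath_left {a b : Fin ℓ} {p : ℕ} (j : Fin (n a)) (h : (j : ℕ) + p = n a) :
    branchPath n a b p = some ⟨a, j⟩ := by
  rw [branchPath, dif_pos (by omega)]
  exact some_branch_ext (by simp; omega)

theorem branchPath_right {a b : Fin ℓ} {p : ℕ} (j : Fin (n b)) (h : (j : ℕ) + n a + 2 = p) :
    branchPath n a b p = some ⟨b, j⟩ := by
  rw [branchPath, dif_neg (by omega), dif_pos (by omega)]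
  exact some_branch_ext (by simp; omega)

theorem branchPath_center {a b : Fin ℓ} : branchPath n a b (n a + 1) = none := by
  rw [branchPath, dif_neg (by omega), dif_neg (by omega)]

theorem branchPath_cases {a b : Fin ℓ} {p : ℕ} (h0 : 0 < p) (h1 : p < n a + n b + 2) :
    (∃ j : Fin (n a), (j : ℕ) + p = n a) ∨ p = n a + 1 ∨
      ∃ j : Fin (n b), (j : ℕ) + n a + 2 = p := by
  by_cases h2 : p ≤ n a
  · exact Or.inl ⟨⟨n a - p, by omega⟩, by simp; omega⟩
  by_cases h3 : p = n a + 1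
  · exact Or.inr (Or.inl h3)
  · exact Or.inr (Or.inr ⟨⟨p - n a - 2, by omega⟩, by simp; omega⟩)

theorem branchPath_inj {a b : Fin ℓ} (hab : a ≠ b) {p q : ℕ} (hp : 0 < p)
    (hp' : p < n a + n b + 2) (hq : 0 < q) (hq' : q < n a + n b + 2)
    (h : branchPath n a b p = branchPath n a b q) : p = q := by
  let pos : Option (Σ i : Fin ℓ, Fin (n i)) → ℕ
    | none => n a + 1
    | some ⟨i, j⟩ => if i = a then n a - j else j + n a + 2
  have hpos : ∀ p, 0 < p → p < n a + n b + 2 → pos (branchPath n a b p) = p := by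
    intro p hp hp'
    rcases branchPath_cases hp hp' with ⟨j, hj⟩ | rfl | ⟨j, hj⟩
    · rw [branchPath_left j hj]
      simp only [pos, if_true]
      omega
    · rw [branchPath_center]
    · rw [branchPath_right j hj]
      simpa only [pos, if_neg hab.symm]
  rw [← hpos p hp hp', h, hpos q hq hq']

theorem gammaSMB'_subdividedStar_le {a b : Fin ℓ} (hab : a ≠ b) (hoa : Odd (n a))
    (hob : Odd (n b)) {K : ℕ} (hK : n a + n b + 2 ≤ 2 * 2 ^ K) :
    gammaSMB' (subdividedStar ℓ n) ≤ (K + 1 : ℕ) := by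
  obtain ⟨s, hs⟩ := hoa
  obtain ⟨t, ht⟩ := hob
  refine mbVal_le_of_path (T := s + t + 2) (c := branchPath n a b) ?_ ?_ K 0 (s + t + 2) ∅ ∅
    (by omega) le_rfl (Or.inl rfl) (Or.inl rfl) (by simp) (by omega)
  · exact fun p q hp hp' hq hq' => branchPath_inj hab hp (by omega) hq (by omega)
  · intro m hm
    refine ⟨_, ⟨branchPath n a b (2 * m + 1), rfl⟩, fun v hv => ?_⟩
    simp only [closedNbhdFinset, Finset.mem_filter, Finset.mem_univ, true_and] at hv
    refine hv.imp_right fun hadj => ?_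
    rcases branchPath_cases (n := n) (a := a) (b := b) (p := 2 * m + 1) (by omega) (by omega) with
      ⟨j, hj⟩ | h | ⟨j, hj⟩
    · rw [branchPath_left j hj] at hadj
      rcases subdividedStar_adj_cases hadj with ⟨h0, rfl⟩ | ⟨j', rfl, h0 | h0⟩
      · refine Or.inr ⟨by omega, ?_⟩
        rw [show 2 * m + 2 = n a + 1 by omega, branchPath_center]
      · exact Or.inl ⟨by omega, (branchPath_left j' (by omega)).symm⟩
      · exact Or.inr ⟨by omega, (branchPath_left j' (by omega)).symm⟩
    · omega
    · rw [branchPath_right j hj] at hadj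
      rcases subdividedStar_adj_cases hadj with ⟨h0, rfl⟩ | ⟨j', rfl, h0 | h0⟩
      · refine Or.inl ⟨by omega, ?_⟩
        rw [show 2 * m = n a + 1 by omega, branchPath_center]
      · exact Or.inr ⟨by omega, (branchPath_right j' (by omega)).symm⟩
      · exact Or.inl ⟨by omega, (branchPath_right j' (by omega)).symm⟩

end Spider

/-- If the subdivided star `S(n_1, …, n_ℓ)` has at least two odd branches and
`n a`, `n b` are the two smallest odd branch orders, then
`γ'_SMB(S(n_1, …, n_ℓ)) = ⌈log₂(n a + n b + 1)⌉`. -/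
theorem stmt_10 (ℓ : ℕ) (hℓ : 2 ≤ ℓ) (n : ℕ → ℕ) (hpos : ∀ i < ℓ, 0 < n i)
    (a b : ℕ) (ha : a < ℓ) (hb : b < ℓ) (hab : a ≠ b)
    (hoa : Odd (n a)) (hob : Odd (n b))
    (hmin : ∀ i < ℓ, i ≠ a → i ≠ b → Odd (n i) → n a ≤ n i ∧ n b ≤ n i) :
    gammaSMB' (subdividedStar ℓ n) = (Nat.clog 2 (n a + n b + 1) : ℕ) := by
  obtain ⟨K, hK⟩ : ∃ K, Nat.clog 2 (n a + n b + 1) = K + 1 :=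
    Nat.exists_eq_succ_of_ne_zero (Nat.clog_pos one_lt_two (by have := hpos a ha; omega)).ne'
  have hlt : 2 ^ K < n a + n b + 1 :=
    (Nat.lt_clog_iff_pow_lt one_lt_two).mp (by omega)
  have hle : n a + n b + 1 ≤ 2 ^ (K + 1) := (Nat.clog_le_iff_le_pow one_lt_two).mp hK.le
  rw [hK]
  refine le_antisymm ?_ ?_
  · refine gammaSMB'_subdividedStar_le (a := ⟨a, ha⟩) (b := ⟨b, hb⟩) (by simpa using hab) hoa hob ?_
    obtain ⟨s, hs⟩ := hoa
    obtain ⟨t, ht⟩ := hob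
    simp only [pow_succ] at hle ⊢
    omega
  · refine lt_gammaSMB'_subdividedStar ⟨a, ha⟩ hoa fun i j hij hi hj => ?_
    have h1 := hmin i i.isLt
    have h2 := hmin j j.isLt
    have h3 : (i : ℕ) ≠ j := fun h => hij (Fin.ext h)
    grind
end

section
/- For every integer k ≥ 1, γ'_SMB(S(2k, 2k, 2k)) = ⌈log_2(4k+1)⌉ + 1, where S(2k,2k,2k) is the spider with three legs each of length 2k. -/
open scoped Classical

open scoped Classical

section Game

variable {V : Type} [Fintype V] {E : Set (Finset V)}

theorem one_le_mbVal {M B : Finset V} (h : ∀ e ∈ E, ¬ e ⊆ M) : 1 ≤ mbVal E true M B := by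
  rw [mbVal, if_neg (by push Not; exact h)]
  exact le_iInf fun v => le_iInf fun _ => le_self_add

theorem not_subset_of_one_le_mbVal {M B : Finset V} (h : 1 ≤ mbVal E true M B) :
    ∀ e ∈ E, ¬ e ⊆ M := by
  intro e he hM
  rw [mbVal, if_pos ⟨e, he, hM⟩] at h
  simp at h

/-- Breaker survives one more round when he has an answer `w` to every move `v`; the answer
`w` is void if `w` is already taken, and then any other move of his must do. -/
theorem succ_le_mbVal {M B : Finset V} {N : ℕ} (hN : 1 ≤ N) (hMB : Disjoint M B)
    (hM : ∀ e ∈ E, ¬ e ⊆ M)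
    (h : ∀ v, v ∉ M → v ∉ B → ∃ w, ∀ B', B ⊆ B' → (w ∉ insert v M → w ∈ B') →
      Disjoint (insert v M) B' → (N : ℕ∞) ≤ mbVal E true (insert v M) B') :
    ((N + 1 : ℕ) : ℕ∞) ≤ mbVal E true M B := by
  rw [mbVal, if_neg (by push Not; exact hM)]
  refine le_iInf fun v => le_iInf fun hv => ?_
  simp only [Finset.mem_sdiff, Finset.mem_univ, true_and, Finset.mem_union, not_or] at hv
  obtain ⟨w, hw⟩ := h v hv.1 hv.2
  have hdisj : Disjoint (insert v M) B := by
    rw [Finset.disjoint_insert_left]; exact ⟨hv.2, hMB⟩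
  have hins : ∀ u, u ∉ insert v M → Disjoint (insert v M) (insert u B) := by
    intro u hu
    rw [Finset.disjoint_insert_right]; exact ⟨hu, hdisj⟩
  have hN' : (1 : ℕ∞) ≤ N := by exact_mod_cast hN
  have hne : ¬ ∃ e ∈ E, e ⊆ insert v M := by
    push Not
    by_cases hwM : w ∈ insert v M
    · exact not_subset_of_one_le_mbVal
        (hN'.trans (hw B subset_rfl (fun h => absurd hwM h) hdisj))
    · exact not_subset_of_one_le_mbVal
        (hN'.trans (hw _ (Finset.subset_insert w B) (fun _ => Finset.mem_insert_self _ _)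
          (hins w hwM)))
  rw [Nat.cast_add, add_comm, Nat.cast_one]
  refine add_le_add le_rfl ?_
  rw [mbVal, if_neg hne]
  split_ifs with hfree
  · exact le_top
  · obtain ⟨u, hu⟩ := Finset.nonempty_iff_ne_empty.2 hfree
    by_cases hwf : w ∈ Finset.univ \ (insert v M ∪ B)
    · refine le_trans ?_ (le_iSup₂_of_le w hwf le_rfl)
      simp only [Finset.mem_sdiff, Finset.mem_univ, true_and, Finset.mem_union, not_or] at hwf
      exact hw _ (Finset.subset_insert w B) (fun _ => Finset.mem_insert_self _ _)
        (hins w hwf.1)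
    · refine le_trans ?_ (le_iSup₂_of_le u hu le_rfl)
      simp only [Finset.mem_sdiff, Finset.mem_univ, true_and, Finset.mem_union, not_or] at hu hwf
      refine hw _ (Finset.subset_insert u B) (fun h => ?_) (hins u hu.1)
      exact Finset.mem_insert_of_mem (by tauto)

theorem mbVal_le_succ {M B : Finset V} {N : ℕ} {v u : V} (hvM : v ∉ M) (hvB : v ∉ B)
    (hu : u ∉ insert v M) (huB : u ∉ B)
    (h : ∀ w, w ∉ insert v M → w ∉ B → mbVal E true (insert v M) (insert w B) ≤ N) :
    mbVal E true M B ≤ (N + 1 : ℕ) := by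
  rw [mbVal]
  split_ifs with hM
  · exact zero_le
  refine iInf₂_le_of_le v (by simp [hvM, hvB]) ?_
  rw [Nat.cast_add, add_comm, Nat.cast_one]
  refine add_le_add ?_ le_rfl
  rw [mbVal]
  split_ifs with h1 h2
  · exact zero_le
  · exfalso
    have : u ∈ Finset.univ \ (insert v M ∪ B) := by
      simp only [Finset.mem_sdiff, Finset.mem_univ, true_and, Finset.mem_union, not_or]
      exact ⟨hu, huB⟩
    rw [h2] at this
    simp at this
  · refine iSup₂_le fun w hw => ?_
    simp only [Finset.mem_sdiff, Finset.mem_univ, true_and, Finset.mem_union, not_or] at hw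
    exact h w hw.1 hw.2

theorem mbVal_le_one {M B e : Finset V} {v : V} (he : e ∈ E) (hvM : v ∉ M) (hvB : v ∉ B)
    (hev : e ⊆ insert v M) : mbVal E true M B ≤ 1 := by
  rw [mbVal]
  split_ifs with hM
  · exact zero_le
  refine iInf₂_le_of_le v (by simp [hvM, hvB]) ?_
  rw [mbVal, if_pos ⟨e, he, hev⟩, add_zero]

/-- Maker wins on a free path of odd order `n < 2 ^ N` within `N` moves. -/
theorem mbVal_le_of_path_s16 (N : ℕ) : ∀ (M B : Finset V) (n : ℕ) (p : ℕ → V), Odd n → n < 2 ^ N →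
    (∀ i < n, ∀ j < n, p i = p j → i = j) → (∀ i < n, p i ∉ M ∧ p i ∉ B) →
    (∀ i < n, ∃ e ∈ E, ∀ w ∈ e, w ∈ M ∨ ∃ j < n, (j = i ∨ j + 1 = i ∨ j = i + 1) ∧ w = p j) →
    mbVal E true M B ≤ N := by
  induction N with
  | zero =>
    intro M B n p hn hlt
    obtain ⟨m, rfl⟩ := hn
    simp at hlt
  | succ N ih =>
    intro M B n p hn hlt hinj hfree hE
    obtain ⟨m, rfl⟩ := hn
    rcases Nat.eq_zero_or_pos m with rfl | hm
    · obtain ⟨e, he, hsub⟩ := hE 0 (by simp)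
      refine (mbVal_le_one he (hfree 0 (by simp)).1 (hfree 0 (by simp)).2 ?_).trans
        (by exact_mod_cast Nat.le_add_left 1 N)
      intro w hw
      rcases hsub w hw with h | ⟨j, hj, -, rfl⟩
      · exact Finset.mem_insert_of_mem h
      · obtain rfl : j = 0 := by omega
        exact Finset.mem_insert_self _ _
    · obtain ⟨i, hi0, hi, hiodd, hl, hr⟩ : ∃ i, 0 < i ∧ i < 2 * m ∧ i % 2 = 1 ∧ i < 2 ^ N ∧
          2 * m - i < 2 ^ N := by
        rw [pow_succ] at hlt
        have hN : N ≠ 0 := by rintro rfl; simp at hlt; omega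
        have h2 : 2 ∣ 2 ^ N := dvd_pow_self 2 hN
        rcases Nat.mod_two_eq_zero_or_one m with h | h
        · exact ⟨m + 1, by omega⟩
        · exact ⟨m, by omega⟩
      have hp : ∀ j < 2 * m + 1, j ≠ i → p j ∉ insert (p i) M := by
        intro j hj hji
        rw [Finset.mem_insert, not_or]
        exact ⟨fun h => hji (hinj _ hj _ (by omega) h), (hfree j hj).1⟩
      refine mbVal_le_succ (hfree i (by omega)).1 (hfree i (by omega)).2
        (hp 0 (by omega) (by omega)) (hfree 0 (by omega)).2 fun w hwM hwB => ?_
      by_cases hw : ∃ j < i, w = p j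
      · obtain ⟨j, hj, rfl⟩ := hw
        refine ih _ _ (2 * m - i) (fun t => p (i + 1 + t)) (by rw [Nat.odd_iff]; omega) hr
          (fun a ha b hb hab => ?_) (fun a ha => ⟨hp _ (by omega) (by omega), ?_⟩)
          (fun a ha => ?_)
        · have := hinj _ (by omega) _ (by omega) hab
          omega
        · rw [Finset.mem_insert, not_or]
          refine ⟨fun h => ?_, (hfree _ (by omega)).2⟩
          have := hinj _ (by omega) _ (by omega) h
          omega
        · obtain ⟨e, he, hsub⟩ := hE (i + 1 + a) (by omega)
          refine ⟨e, he, fun x hx => ?_⟩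
          rcases hsub x hx with h | ⟨t, ht, hta, rfl⟩
          · exact Or.inl (Finset.mem_insert_of_mem h)
          · by_cases hti : t = i
            · subst hti; exact Or.inl (Finset.mem_insert_self _ _)
            · refine Or.inr ⟨t - (i + 1), by omega, by omega, ?_⟩
              congr 1; omega
      · refine ih _ _ i p (by rw [Nat.odd_iff]; omega) hl
          (fun a ha b hb hab => hinj _ (by omega) _ (by omega) hab)
          (fun a ha => ⟨hp _ (by omega) (by omega), ?_⟩) (fun a ha => ?_)
        · rw [Finset.mem_insert, not_or]
          exact ⟨fun h => hw ⟨a, ha, h.symm⟩, (hfree _ (by omega)).2⟩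
        · obtain ⟨e, he, hsub⟩ := hE a (by omega)
          refine ⟨e, he, fun x hx => ?_⟩
          rcases hsub x hx with h | ⟨t, ht, hta, rfl⟩
          · exact Or.inl (Finset.mem_insert_of_mem h)
          · by_cases hti : t = i
            · subst hti; exact Or.inl (Finset.mem_insert_self _ _)
            · exact Or.inr ⟨t, by omega, hta, rfl⟩

end Game

section Defence

variable {V : Type} {E : Set (Finset V)}

/-- A defence for Breaker at the position `(M, B)`: every hyperedge is hit by Breaker, contains
a pair of the matching `R`, or contains a closed neighborhood of the path `p 0, …, p (n - 1)`. -/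
structure IsDefence (E : Set (Finset V)) (M B : Finset V) (n : ℕ) (p : ℕ → V)
    (R : V → V → Prop) : Prop where
  disjoint : Disjoint M B
  inj : ∀ i < n, ∀ j < n, p i = p j → i = j
  notMem : ∀ i < n, p i ∉ M
  symm : ∀ a b, R a b → R b a
  irrefl : ∀ a, ¬ R a a
  unique : ∀ a b c, R a b → R a c → b = c
  off : ∀ a b, R a b → ∀ i < n, p i ≠ a
  answered : ∀ a b, R a b → a ∈ M → b ∈ B
  cover : ∀ e ∈ E, (∃ b ∈ e, b ∈ B) ∨ (∃ a ∈ e, ∃ b ∈ e, R a b) ∨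
    ∃ i < n, p i ∈ e ∧ (0 < i → p (i - 1) ∈ e) ∧ (i + 1 < n → p (i + 1) ∈ e)

namespace IsDefence

variable {M B : Finset V} {n : ℕ} {p : ℕ → V} {R : V → V → Prop}

theorem not_subset (h : IsDefence E M B n p R) : ∀ e ∈ E, ¬ e ⊆ M := by
  intro e he hM
  rcases h.cover e he with ⟨b, hb, hbB⟩ | ⟨a, ha, b, hb, hab⟩ | ⟨i, hi, hpi, -⟩
  · exact Finset.disjoint_left.1 h.disjoint (hM hb) hbB
  · exact Finset.disjoint_left.1 h.disjoint (hM hb) (h.answered a b hab (hM ha))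
  · exact h.notMem i hi (hM hpi)

theorem insert_off_path (h : IsDefence E M B n p R) {v : V} {B' : Finset V} (hB : B ⊆ B')
    (hdisj : Disjoint (insert v M) B') (hv : ∀ i < n, p i ≠ v) (hR : ∀ b, R v b → b ∈ B') :
    IsDefence E (insert v M) B' n p R where
  disjoint := hdisj
  inj := h.inj
  notMem i hi := by
    rw [Finset.mem_insert, not_or]
    exact ⟨hv i hi, h.notMem i hi⟩
  symm := h.symm
  irrefl := h.irrefl
  unique := h.unique
  off := h.off
  answered a b hab ha := by
    rcases Finset.mem_insert.1 ha with rfl | ha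
    · exact hR b hab
    · exact hB (h.answered a b hab ha)
  cover e he := by
    rcases h.cover e he with ⟨b, hb, hbB⟩ | h' | h'
    · exact Or.inl ⟨b, hb, hB hbB⟩
    · exact Or.inr (Or.inl h')
    · exact Or.inr (Or.inr h')

/-- After Maker plays `p i`, the path is cut down to the part `p s, …, p (s + m - 1)`, and the
pairs `p j, p (j + 1)` with `S j` join the matching. -/
theorem insert_on_path (h : IsDefence E M B n p R) {i s m : ℕ} {S : ℕ → Prop} {B' : Finset V}
    (hi : i < n) (hB : B ⊆ B') (hdisj : Disjoint (insert (p i) M) B') (hsm : s + m ≤ n)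
    (his : i < s ∨ s + m ≤ i) (hS : ∀ j, S j → ¬ S (j + 1))
    (hSs : ∀ j, S j → j ≠ i ∧ j + 1 ≠ i ∧ j + 1 < n ∧ (j + 1 < s ∨ s + m ≤ j))
    (hcov : ∀ j < n, (∃ t < n, (t = j ∨ t + 1 = j ∨ t = j + 1) ∧ p t ∈ B') ∨
      (∃ t, (t = j ∨ t + 1 = j) ∧ S t) ∨ (s ≤ j ∧ j < s + m)) :
    ∃ p' R', IsDefence E (insert (p i) M) B' m p' R' := by
  refine ⟨fun t => p (s + t), fun a b => R a b ∨ ∃ j, S j ∧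
    ((a = p j ∧ b = p (j + 1)) ∨ (a = p (j + 1) ∧ b = p j)), hdisj, ?_, ?_, ?_, ?_, ?_, ?_, ?_, ?_⟩
  · intro a ha b hb hab
    have := h.inj _ (by omega) _ (by omega) hab
    omega
  · intro t ht
    rw [Finset.mem_insert, not_or]
    refine ⟨fun hti => ?_, h.notMem _ (by omega)⟩
    have := h.inj _ (by omega) _ hi hti
    omega
  · rintro a b (hab | ⟨j, hj, hab⟩)
    · exact Or.inl (h.symm _ _ hab)
    · exact Or.inr ⟨j, hj, by tauto⟩
  · rintro a (haa | ⟨j, hj, hab⟩)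
    · exact h.irrefl a haa
    · have hj' := hSs j hj
      have : p j = p (j + 1) := by rcases hab with ⟨h1, h2⟩ | ⟨h1, h2⟩ <;> rw [← h1, ← h2]
      have := h.inj _ (by omega) _ (by omega) this
      omega
  · rintro a b c (hab | ⟨j, hj, hab⟩) (hac | ⟨j', hj', hac⟩)
    · exact h.unique _ _ _ hab hac
    · exfalso
      have := hSs j' hj'
      rcases hac with ⟨h1, -⟩ | ⟨h1, -⟩ <;> exact h.off _ _ hab _ (by omega) h1.symm
    · exfalso
      have := hSs j hj
      rcases hab with ⟨h1, -⟩ | ⟨h1, -⟩ <;> exact h.off _ _ hac _ (by omega) h1.symm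
    · have h1 := hSs j hj
      have h2 := hSs j' hj'
      rcases hab with ⟨ha, rfl⟩ | ⟨ha, rfl⟩ <;> rcases hac with ⟨ha', rfl⟩ | ⟨ha', rfl⟩ <;>
        have he := h.inj _ (by omega) _ (by omega) (ha.symm.trans ha')
      · rw [he]
      · exact absurd (he ▸ hj) (hS _ hj')
      · exact absurd (he ▸ hj') (hS _ hj)
      · congr 1; omega
  · rintro a b (hab | ⟨j, hj, hab⟩) t ht hta
    · exact h.off _ _ hab _ (by omega) hta
    · have h1 := hSs j hj
      rcases hab with ⟨ha, -⟩ | ⟨ha, -⟩ <;>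
        have he := h.inj _ (by omega) _ (by omega) (hta.trans ha) <;> omega
  · rintro a b (hab | ⟨j, hj, hab⟩) ha
    · rcases Finset.mem_insert.1 ha with rfl | ha
      · exact absurd rfl (h.off _ _ hab _ hi)
      · exact hB (h.answered _ _ hab ha)
    · exfalso
      have h1 := hSs j hj
      have key : ∀ t < n, t ≠ i → p t ∉ insert (p i) M := by
        intro t ht hti
        rw [Finset.mem_insert, not_or]
        exact ⟨fun h' => hti (h.inj _ ht _ hi h'), h.notMem t ht⟩
      rcases hab with ⟨rfl, -⟩ | ⟨rfl, -⟩ <;> exact key _ (by omega) (by omega) ha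
  · intro e he
    rcases h.cover e he with ⟨b, hb, hbB⟩ | ⟨a, ha, b, hb, hab⟩ | ⟨j, hj, h0, h1, h2⟩
    · exact Or.inl ⟨b, hb, hB hbB⟩
    · exact Or.inr (Or.inl ⟨a, ha, b, hb, Or.inl hab⟩)
    · rcases hcov j hj with ⟨t, ht, htj, htB⟩ | ⟨t, htj, hSt⟩ | ⟨h3, h4⟩
      · refine Or.inl ⟨p t, ?_, htB⟩
        rcases htj with rfl | rfl | rfl
        · exact h0
        · exact h1 (by omega)
        · exact h2 ht
      · refine Or.inr (Or.inl ⟨p t, ?_, p (t + 1), ?_, Or.inr ⟨t, hSt, Or.inl ⟨rfl, rfl⟩⟩⟩)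
        · rcases htj with rfl | rfl
          · exact h0
          · exact h1 (by omega)
        · have := hSs t hSt
          rcases htj with rfl | rfl
          · exact h2 (by omega)
          · exact h0
      · refine Or.inr (Or.inr ⟨j - s, by omega, ?_, fun h5 => ?_, fun h5 => ?_⟩)
        · rwa [show s + (j - s) = j by omega]
        · rw [show s + (j - s - 1) = j - 1 by omega]
          exact h1 (by omega)
        · rw [show s + (j - s + 1) = j + 1 by omega]
          exact h2 (by omega)

theorem le_mbVal [Fintype V] (N : ℕ) : ∀ {M B : Finset V} {n : ℕ} {p : ℕ → V} {R : V → V → Prop},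
    IsDefence E M B n p R → (n = 0 ∨ Odd n ∧ 2 ^ N ≤ 2 * n) → (N : ℕ∞) ≤ mbVal E true M B := by
  induction N with
  | zero => intros; simp
  | succ N ih =>
    intro M B n p R h hn
    rcases Nat.eq_zero_or_pos N with rfl | hN
    · simpa using one_le_mbVal h.not_subset
    refine succ_le_mbVal hN h.disjoint h.not_subset fun v hvM hvB => ?_
    by_cases hv : ∃ i < n, p i = v
    · obtain ⟨i, hi, rfl⟩ := hv
      obtain ⟨hodd, hle⟩ : n % 2 = 1 ∧ 2 ^ N ≤ n := by
        rcases hn with rfl | ⟨h1, h2⟩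
        · omega
        · rw [Nat.odd_iff] at h1
          rw [pow_succ] at h2
          omega
      have h2 : 2 ∣ 2 ^ N := dvd_pow_self 2 (by omega)
      have h2' : 0 < 2 ^ N := by positivity
      have hp : ∀ j < n, j ≠ i → p j ∉ insert (p i) M := by
        intro j hj hji
        rw [Finset.mem_insert, not_or]
        exact ⟨fun h' => hji (h.inj _ hj _ hi h'), h.notMem j hj⟩
      rcases Nat.mod_two_eq_zero_or_one i with hpar | hpar
      · obtain ⟨w, hwn, hwi, hw⟩ : ∃ w, w < n ∧ w ≠ i ∧ (w + 1 = i ∨ w = i + 1) := by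
          rcases Nat.eq_zero_or_pos i with rfl | h0
          · exact ⟨1, by omega⟩
          · exact ⟨i - 1, by omega⟩
        refine ⟨p w, fun B' hB hwB hdisj => ?_⟩
        replace hwB := hwB (hp w hwn hwi)
        obtain ⟨p', R', h'⟩ := h.insert_on_path (s := i + 1) (m := 0)
          (S := fun j => (j % 2 = 0 ∧ j + 1 < i) ∨ (j % 2 = 1 ∧ i < j ∧ j + 1 < n))
          hi hB hdisj (by omega) (by omega) (by intro j; omega)
          (by intro j; omega) (by
            intro j hj
            rcases lt_trichotomy j i with hji | rfl | hji
            · exact Or.inr (Or.inl ⟨j - j % 2, by omega, by omega⟩)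
            · exact Or.inl ⟨w, hwn, by omega, hwB⟩
            · exact Or.inr (Or.inl ⟨j - (j + 1) % 2, by omega, by omega⟩))
        exact ih h' (Or.inl rfl)
      · rcases le_total i (n - 1 - i) with hside | hside
        · refine ⟨p (i - 1), fun B' hB hwB hdisj => ?_⟩
          replace hwB := hwB (hp _ (by omega) (by omega))
          obtain ⟨p', R', h'⟩ := h.insert_on_path (s := i + 1) (m := n - 1 - i)
            (S := fun j => j % 2 = 0 ∧ j + 1 < i)
            hi hB hdisj (by omega) (by omega) (by intro j; omega)
            (by intro j; omega) (by
              intro j hj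
              rcases lt_or_ge i j with hji | hji
              · exact Or.inr (Or.inr (by omega))
              · by_cases hj1 : j + 1 < i
                · exact Or.inr (Or.inl ⟨j - j % 2, by omega, by omega⟩)
                · exact Or.inl ⟨i - 1, by omega, by omega, hwB⟩)
          exact ih h' (Or.inr ⟨by rw [Nat.odd_iff]; omega, by omega⟩)
        · refine ⟨p (i + 1), fun B' hB hwB hdisj => ?_⟩
          replace hwB := hwB (hp _ (by omega) (by omega))
          obtain ⟨p', R', h'⟩ := h.insert_on_path (s := 0) (m := i)
            (S := fun j => j % 2 = 1 ∧ i < j ∧ j + 1 < n)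
            hi hB hdisj (by omega) (by omega) (by intro j; omega)
            (by intro j; omega) (by
              intro j hj
              rcases lt_or_ge j i with hji | hji
              · exact Or.inr (Or.inr (by omega))
              · by_cases hj1 : i + 1 < j
                · exact Or.inr (Or.inl ⟨j - (j + 1) % 2, by omega, by omega⟩)
                · exact Or.inl ⟨i + 1, by omega, by omega, hwB⟩)
          exact ih h' (Or.inr ⟨by rw [Nat.odd_iff]; omega, by omega⟩)
    · push Not at hv
      have hn' : n = 0 ∨ Odd n ∧ 2 ^ N ≤ 2 * n := by
        refine hn.imp_right fun ⟨h1, h2⟩ => ⟨h1, le_trans ?_ h2⟩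
        exact Nat.pow_le_pow_right (by norm_num) (by omega)
      by_cases hR : ∃ b, R v b
      · obtain ⟨b, hb⟩ := hR
        refine ⟨b, fun B' hB hbB hdisj => ih (h.insert_off_path hB hdisj hv fun c hc => ?_) hn'⟩
        rw [h.unique _ _ _ hc hb]
        refine hbB ?_
        rw [Finset.mem_insert, not_or]
        refine ⟨?_, fun hbM => hvB (h.answered _ _ (h.symm _ _ hb) hbM)⟩
        rintro rfl
        exact h.irrefl _ hb
      · push Not at hR
        exact ⟨v, fun B' hB _ hdisj =>
          ih (h.insert_off_path hB hdisj hv fun c hc => absurd hc (hR c)) hn'⟩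

end IsDefence

/-- `E` is the closed neighborhood hypergraph of the spider with three legs of length `r`, where
`q l t` is the vertex at distance `t` from the center on leg `l`. -/
structure IsSpider (E : Set (Finset V)) (r : ℕ) (q : Fin 3 → ℕ → V) : Prop where
  eq_iff : ∀ l l' t t', t ≤ r → t' ≤ r →
    (q l t = q l' t' ↔ (t = 0 ∧ t' = 0) ∨ (l = l' ∧ t = t'))
  surj : ∀ v, ∃ l, ∃ t ≤ r, v = q l t
  nbhd : ∀ e, e ∈ E ↔ ∃ l, ∃ t ≤ r, ∀ w, w ∈ e ↔
    (t = 0 ∧ ∃ l', w = q l' 1) ∨ ∃ s ≤ r, (s = t ∨ s + 1 = t ∨ s = t + 1) ∧ w = q l s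

/-- The path from the end of leg `l` through the center to the end of leg `l'`. -/
def twoLegs (r : ℕ) (q : Fin 3 → ℕ → V) (l l' : Fin 3) (t : ℕ) : V :=
  if t ≤ r then q l (r - t) else q l' (t - r)

/-- The matching of the vertices `q l t` and `q l (t + 1)` with `S l t`. -/
def legPairs (r : ℕ) (q : Fin 3 → ℕ → V) (S : Fin 3 → ℕ → Prop) (a b : V) : Prop :=
  ∃ l t, S l t ∧ t + 1 ≤ r ∧ ((a = q l t ∧ b = q l (t + 1)) ∨ (a = q l (t + 1) ∧ b = q l t))

namespace IsSpider

variable {r : ℕ} {q : Fin 3 → ℕ → V}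

theorem legPairs_symm {S : Fin 3 → ℕ → Prop} {a b : V} (h : legPairs r q S a b) :
    legPairs r q S b a := by
  obtain ⟨l, t, h1, h2, h3⟩ := h
  exact ⟨l, t, h1, h2, by tauto⟩

theorem legPairs_irrefl (hs : IsSpider E r q) {S : Fin 3 → ℕ → Prop} {a : V} :
    ¬ legPairs r q S a a := by
  rintro ⟨l, t, h1, h2, h3⟩
  have : q l t = q l (t + 1) := by rcases h3 with ⟨h1, h2⟩ | ⟨h1, h2⟩ <;> rw [← h1, ← h2]
  rw [hs.eq_iff _ _ _ _ (by omega) (by omega)] at this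
  omega

theorem legPairs_unique (hs : IsSpider E r q) {S : Fin 3 → ℕ → Prop}
    (hS : ∀ l t, S l t → ¬ S l (t + 1)) (hS0 : ∀ l l', S l 0 → S l' 0 → l = l') {a b c : V}
    (hab : legPairs r q S a b) (hac : legPairs r q S a c) : b = c := by
  obtain ⟨l, t, hl, ht, hab⟩ := hab
  obtain ⟨l', t', hl', ht', hac⟩ := hac
  rcases hab with ⟨ha, rfl⟩ | ⟨ha, rfl⟩ <;> rcases hac with ⟨ha', rfl⟩ | ⟨ha', rfl⟩ <;>
    have he := (hs.eq_iff _ _ _ _ (by omega) (by omega)).1 (ha.symm.trans ha')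
  · rcases he with ⟨rfl, rfl⟩ | ⟨rfl, rfl⟩
    · rw [hS0 _ _ hl hl']
    · rfl
  · rcases he with ⟨h1, h2⟩ | ⟨rfl, rfl⟩
    · omega
    · exact absurd hl (hS _ _ hl')
  · rcases he with ⟨h1, h2⟩ | ⟨rfl, rfl⟩
    · omega
    · exact absurd hl' (hS _ _ hl)
  · rcases he with ⟨h1, h2⟩ | ⟨rfl, h2⟩
    · omega
    · congr 1; omega

theorem twoLegs_inj (hs : IsSpider E r q) {l l' : Fin 3} (hl : l ≠ l') :
    ∀ i < 2 * r + 1, ∀ j < 2 * r + 1, twoLegs r q l l' i = twoLegs r q l l' j → i = j := by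
  intro i hi j hj hij
  unfold twoLegs at hij
  split_ifs at hij <;> rw [hs.eq_iff _ _ _ _ (by omega) (by omega)] at hij <;> omega

/-- A matching of leg vertices avoiding Maker's vertex `q l t`, which with Breaker's answers hits
every closed neighborhood, keeps Maker from winning. -/
theorem isDefence_legPairs (hs : IsSpider E r q) {S : Fin 3 → ℕ → Prop}
    (hS : ∀ l t, S l t → ¬ S l (t + 1)) (hS0 : ∀ l l', S l 0 → S l' 0 → l = l')
    {i : Fin 3} {j : ℕ} {M B : Finset V} (hM : ∀ v ∈ M, v = q i j)
    (hMB : Disjoint M B)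
    (hSM : ∀ l t, S l t → t + 1 ≤ r → q l t ≠ q i j ∧ q l (t + 1) ≠ q i j)
    (hcov : ∀ l t, t ≤ r → (∃ s ≤ r, (s = t ∨ s + 1 = t ∨ s = t + 1) ∧
        (q l s ∈ B ∨ S l s ∧ s ≤ t ∧ s + 1 ≤ r)) ∨
      (t = 0 ∧ ∃ l', q l' 1 ∈ B ∨ (1 ≤ r ∧ S l' 0))) :
    IsDefence E M B 0 (q 0) (legPairs r q S) where
  disjoint := hMB
  inj := by simp
  notMem := by simp
  symm _ _ := legPairs_symm
  irrefl _ := hs.legPairs_irrefl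
  unique _ _ _ := hs.legPairs_unique hS hS0
  off := by simp
  answered := by
    rintro a b ⟨l, t, h1, h2, h3⟩ ha
    have := hSM l t h1 h2
    rcases h3 with ⟨rfl, -⟩ | ⟨rfl, -⟩
    · exact absurd (hM _ ha) this.1
    · exact absurd (hM _ ha) this.2
  cover := by
    intro e he
    obtain ⟨l, t, ht, he⟩ := (hs.nbhd e).1 he
    rcases hcov l t ht with ⟨s, hsr, hst, hB | ⟨h1, h2, h3⟩⟩ | ⟨rfl, l', hB | ⟨h1, h2⟩⟩
    · exact Or.inl ⟨_, (he _).2 (Or.inr ⟨s, hsr, hst, rfl⟩), hB⟩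
    · exact Or.inr (Or.inl ⟨q l s, (he _).2 (Or.inr ⟨s, hsr, hst, rfl⟩), q l (s + 1),
        (he _).2 (Or.inr ⟨s + 1, h3, by omega, rfl⟩), l, s, h1, h3, Or.inl ⟨rfl, rfl⟩⟩)
    · exact Or.inl ⟨_, (he _).2 (Or.inl ⟨rfl, l', rfl⟩), hB⟩
    · have hc : q l' 0 = q l 0 := (hs.eq_iff _ _ _ _ (by omega) (by omega)).2 (by simp)
      exact Or.inr (Or.inl ⟨q l' 0, (he _).2 (Or.inr ⟨0, by omega, by omega, hc⟩), q l' 1,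
        (he _).2 (Or.inl ⟨rfl, l', rfl⟩), l', 0, h2, h1, Or.inl ⟨rfl, rfl⟩⟩)

/-- Pairing up one leg leaves only the path formed by the two other legs and the center. -/
theorem isDefence_twoLegs {k : ℕ} (hs : IsSpider E (2 * k) q) (hk : 1 ≤ k) {i i₁ i₂ : Fin 3}
    (h1 : i ≠ i₁) (h2 : i ≠ i₂) (h12 : i₁ ≠ i₂) (hall : ∀ l, l = i ∨ l = i₁ ∨ l = i₂) :
    IsDefence E ∅ ∅ (2 * (2 * k) + 1) (twoLegs (2 * k) q i₁ i₂)
      (legPairs (2 * k) q (fun l t => l = i ∧ t % 2 = 1)) where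
  disjoint := by simp
  inj := hs.twoLegs_inj h12
  notMem := by simp
  symm _ _ := legPairs_symm
  irrefl _ := hs.legPairs_irrefl
  unique _ _ _ := hs.legPairs_unique (by intro l t; omega)
    (by intro l l'; omega)
  off := by
    rintro a b ⟨l, t, ⟨rfl, ht⟩, htr, hab⟩ j hj hja
    unfold twoLegs at hja
    rcases hab with ⟨rfl, -⟩ | ⟨rfl, -⟩ <;> split_ifs at hja <;>
      rw [hs.eq_iff _ _ _ _ (by omega) (by omega)] at hja <;>
      omega
  answered := by simp
  cover := by
    intro e he
    obtain ⟨l, t, ht, he⟩ := (hs.nbhd e).1 he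
    have hc : ∀ l l', q l 0 = q l' 0 := fun l l' =>
      (hs.eq_iff _ _ _ _ (by omega) (by omega)).2 (by simp)
    refine Or.inr ?_
    rcases Nat.eq_zero_or_pos t with rfl | ht0
    · refine Or.inr ⟨2 * k, by omega, ?_, fun _ => ?_, fun _ => ?_⟩
      · rw [twoLegs, if_pos le_rfl, Nat.sub_self]
        exact (he _).2 (Or.inr ⟨0, by omega, by omega, hc _ _⟩)
      · rw [twoLegs, if_pos (by omega), show 2 * k - (2 * k - 1) = 1 by omega]
        exact (he _).2 (Or.inl ⟨rfl, i₁, rfl⟩)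
      · rw [twoLegs, if_neg (by omega), show 2 * k + 1 - 2 * k = 1 by omega]
        exact (he _).2 (Or.inl ⟨rfl, i₂, rfl⟩)
    · have hmem : ∀ s ≤ 2 * k, s = t ∨ s + 1 = t ∨ s = t + 1 → q l s ∈ e :=
        fun s hsr hst => (he _).2 (Or.inr ⟨s, hsr, hst, rfl⟩)
      rcases hall l with rfl | rfl | rfl
      · refine Or.inl ⟨q l (t - (t + 1) % 2), hmem _ (by omega) (by omega),
          q l (t - (t + 1) % 2 + 1), hmem _ (by omega) (by omega), l, t - (t + 1) % 2,
          ⟨rfl, by omega⟩, by omega, Or.inl ⟨rfl, rfl⟩⟩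
      · refine Or.inr ⟨2 * k - t, by omega, ?_, fun _ => ?_, fun _ => ?_⟩
        · rw [twoLegs, if_pos (by omega)]
          exact hmem _ (by omega) (by omega)
        · rw [twoLegs, if_pos (by omega)]
          exact hmem _ (by omega) (by omega)
        · rw [twoLegs, if_pos (by omega)]
          exact hmem _ (by omega) (by omega)
      · refine Or.inr ⟨2 * k + t, by omega, ?_, fun _ => ?_, fun _ => ?_⟩
        · rw [twoLegs, if_neg (by omega)]
          exact hmem _ (by omega) (by omega)
        · by_cases ht1 : t = 1
          · subst ht1
            rw [twoLegs, if_pos (by omega), show 2 * k - (2 * k + 1 - 1) = 0 by omega,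
              hc _ l]
            exact hmem _ (by omega) (by omega)
          · rw [twoLegs, if_neg (by omega)]
            exact hmem _ (by omega) (by omega)
        · rw [twoLegs, if_neg (by omega)]
          exact hmem _ (by omega) (by omega)

theorem exists_other_legs (i : Fin 3) :
    ∃ i₁ i₂, i ≠ i₁ ∧ i ≠ i₂ ∧ i₁ ≠ i₂ ∧ ∀ l : Fin 3, l = i ∨ l = i₁ ∨ l = i₂ := by
  revert i; decide

theorem succ_le_mbVal [Fintype V] {k N : ℕ} (hs : IsSpider E (2 * k) q) (hk : 1 ≤ k) (hN : 1 ≤ N)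
    (hNk : 2 ^ N ≤ 2 * (4 * k + 1)) : ((N + 1 : ℕ) : ℕ∞) ≤ mbVal E true ∅ ∅ := by
  have hdef : ∀ i : Fin 3, ∃ p, IsDefence E ∅ ∅ (2 * (2 * k) + 1) p
      (legPairs (2 * k) q (fun l t => l = i ∧ t % 2 = 1)) ∧ ∀ t ≤ 2 * k, 0 < t →
      ∀ j < 2 * (2 * k) + 1, p j ≠ q i t := by
    intro i
    obtain ⟨i₁, i₂, h1, h2, h12, hall⟩ := exists_other_legs i
    refine ⟨_, hs.isDefence_twoLegs hk h1 h2 h12 hall, fun t ht ht0 j hj h => ?_⟩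
    unfold twoLegs at h
    split_ifs at h <;> rw [hs.eq_iff _ _ _ _ (by omega) (by omega)] at h <;> omega
  obtain ⟨p₀, hp₀, -⟩ := hdef 0
  refine _root_.succ_le_mbVal hN (by simp) hp₀.not_subset fun v _ _ => ?_
  obtain ⟨i, j, hj, rfl⟩ := hs.surj v
  have hM : ∀ v ∈ insert (q i j) (∅ : Finset V), v = q i j := by simp
  have hnot : ∀ l t, t ≤ 2 * k → (0 < t ∨ 0 < j) → (l = i → t ≠ j) →
      q l t ∉ insert (q i j) (∅ : Finset V) := by
    intro l t ht h0 hne hmem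
    have := (hs.eq_iff _ _ _ _ ht hj).1 (hM _ hmem)
    rcases this with h | ⟨h, h'⟩
    · omega
    · exact hne h h'
  rcases Nat.eq_zero_or_pos j with rfl | hj0
  · refine ⟨q 0 1, fun B' _ hB hdisj => ?_⟩
    replace hB := hB (hnot _ _ (by omega) (by omega) (by omega))
    refine (hs.isDefence_legPairs (S := fun _ t => t % 2 = 1) (by intro l t; omega)
      (by intro l t; omega) hM hdisj (fun l t ht htr => ?_)
      (fun l t ht => ?_)).le_mbVal N (Or.inl rfl)
    · constructor <;> (rw [Ne, hs.eq_iff _ _ _ _ (by omega) (by omega)]; omega)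
    · rcases Nat.eq_zero_or_pos t with rfl | ht0
      · exact Or.inr ⟨rfl, 0, Or.inl hB⟩
      · exact Or.inl ⟨t - (t + 1) % 2, by omega, by omega, Or.inr (by omega)⟩
  rcases Nat.mod_two_eq_zero_or_one j with hpar | hpar
  · refine ⟨q i (j - 1), fun B' _ hB hdisj => ?_⟩
    replace hB := hB (hnot _ _ (by omega) (by omega) (by omega))
    refine (hs.isDefence_legPairs (S := fun l t => (l = i ∧ t % 2 = 0 ∧ t + 1 < j) ∨
      (t % 2 = 1 ∧ (l = i → j < t))) (by intro l t; omega)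
      (by intro l t; omega) hM hdisj (fun l t ht htr => ?_)
      (fun l t ht => ?_)).le_mbVal N (Or.inl rfl)
    · constructor <;> (rw [Ne, hs.eq_iff _ _ _ _ (by omega) (by omega)]; omega)
    · rcases Nat.eq_zero_or_pos t with rfl | ht0
      · exact Or.inr ⟨rfl, i, Or.inr ⟨by omega, Or.inl ⟨rfl, by omega, by omega⟩⟩⟩
      · left
        by_cases hl : l = i
        · subst hl
          rcases lt_trichotomy t j with h | rfl | h
          · exact ⟨t - t % 2, by omega, by omega, Or.inr ⟨by omega, by omega, by omega⟩⟩
          · exact ⟨t - 1, by omega, by omega, Or.inl hB⟩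
          · exact ⟨t - (t + 1) % 2, by omega, by omega, Or.inr ⟨by omega, by omega, by omega⟩⟩
        · exact ⟨t - (t + 1) % 2, by omega, by omega, Or.inr
            ⟨Or.inr ⟨by omega, fun h => absurd h hl⟩, by omega, by omega⟩⟩
  · obtain ⟨p, hp, hpq⟩ := hdef i
    refine ⟨q i (j + 1), fun B' hB' hB hdisj => ?_⟩
    replace hB := hB (hnot _ _ (by omega) (by omega) (by omega))
    refine (hp.insert_off_path hB' hdisj (hpq j hj hj0) fun b hb => ?_).le_mbVal N
      (Or.inr ⟨⟨_, rfl⟩, by omega⟩)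
    have : legPairs (2 * k) q (fun l t => l = i ∧ t % 2 = 1) (q i j) (q i (j + 1)) :=
      ⟨i, j, ⟨rfl, hpar⟩, by omega, Or.inl ⟨rfl, rfl⟩⟩
    rwa [hp.unique _ _ _ hb this]

theorem mbVal_le_succ [Fintype V] {k N : ℕ} (hs : IsSpider E (2 * k) q) (hk : 1 ≤ k)
    (hNk : 4 * k + 1 < 2 ^ N) : mbVal E true ∅ ∅ ≤ (N + 1 : ℕ) := by
  have hne : ∀ l t, t ≤ 2 * k → (l = 0 → t ≠ 1) → q l t ∉ insert (q 0 1) (∅ : Finset V) := by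
    intro l t ht h
    simp only [Finset.mem_insert, Finset.notMem_empty, or_false]
    rw [hs.eq_iff _ _ _ _ (by omega) (by omega)]
    rintro (h' | ⟨h', h''⟩)
    · omega
    · exact h h' h''
  have hex : ∀ l t, t ≤ 2 * k → ∃ e ∈ E, ∀ w, w ∈ e ↔
      (t = 0 ∧ ∃ l', w = q l' 1) ∨ ∃ s ≤ 2 * k, (s = t ∨ s + 1 = t ∨ s = t + 1) ∧ w = q l s := by
    intro l t ht
    refine ⟨Finset.univ.filter fun w => (t = 0 ∧ ∃ l', w = q l' 1) ∨
      ∃ s ≤ 2 * k, (s = t ∨ s + 1 = t ∨ s = t + 1) ∧ w = q l s,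
      (hs.nbhd _).2 ⟨l, t, ht, ?_⟩, ?_⟩ <;> simp
  have hc : ∀ l l', q l 0 = q l' 0 := fun l l' =>
    (hs.eq_iff _ _ _ _ (by omega) (by omega)).2 (by simp)
  refine _root_.mbVal_le_succ (v := q 0 1) (u := q 0 0) (by simp) (by simp)
    (hne _ _ (by omega) (by omega)) (by simp) fun w hw _ => ?_
  by_cases hleg : ∃ t ≤ 2 * k, 0 < t ∧ w = q 0 t
  · obtain ⟨t, ht, ht0, rfl⟩ := hleg
    refine mbVal_le_of_path_s16 N _ _ (2 * (2 * k) + 1) (twoLegs (2 * k) q 1 2) ⟨_, rfl⟩ (by omega)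
      (hs.twoLegs_inj (by decide)) (fun i hi => ⟨?_, ?_⟩) (fun i hi => ?_)
    · unfold twoLegs
      split_ifs
      · exact hne _ _ (by omega) (fun h => absurd h (by decide))
      · exact hne _ _ (by omega) (fun h => absurd h (by decide))
    · simp only [Finset.mem_insert, Finset.notMem_empty, or_false]
      unfold twoLegs
      split_ifs <;> rw [hs.eq_iff _ _ _ _ (by omega) (by omega)] <;> omega
    · rcases lt_trichotomy i (2 * k) with hik | rfl | hik
      · obtain ⟨e, he, hmem⟩ := hex 1 (2 * k - i) (by omega)
        refine ⟨e, he, fun w hw => Or.inr ?_⟩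
        rcases (hmem w).1 hw with ⟨h, -⟩ | ⟨s, hs', hst, rfl⟩
        · omega
        · refine ⟨2 * k - s, by omega, by omega, ?_⟩
          rw [twoLegs, if_pos (by omega)]
          congr 1; omega
      · obtain ⟨e, he, hmem⟩ := hex 1 0 (by omega)
        refine ⟨e, he, fun w hw => ?_⟩
        have h1 : q 1 1 = twoLegs (2 * k) q 1 2 (2 * k - 1) := by
          rw [twoLegs, if_pos (by omega)]
          congr 1; omega
        have h2 : q 2 1 = twoLegs (2 * k) q 1 2 (2 * k + 1) := by
          rw [twoLegs, if_neg (by omega)]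
          congr 1; omega
        have h0 : q 1 0 = twoLegs (2 * k) q 1 2 (2 * k) := by
          rw [twoLegs, if_pos (by omega)]
          congr 1; omega
        rcases (hmem w).1 hw with ⟨-, l, rfl⟩ | ⟨s, hs', hst, rfl⟩
        · fin_cases l
          · exact Or.inl (Finset.mem_insert_self _ _)
          · exact Or.inr ⟨2 * k - 1, by omega, by omega, h1⟩
          · exact Or.inr ⟨2 * k + 1, by omega, by omega, h2⟩
        · rcases (by omega : s = 0 ∨ s = 1) with rfl | rfl
          · exact Or.inr ⟨2 * k, by omega, by omega, h0⟩
          · exact Or.inr ⟨2 * k - 1, by omega, by omega, h1⟩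
      · obtain ⟨e, he, hmem⟩ := hex 2 (i - 2 * k) (by omega)
        refine ⟨e, he, fun w hw => Or.inr ?_⟩
        rcases (hmem w).1 hw with ⟨h, -⟩ | ⟨s, hs', hst, rfl⟩
        · omega
        · refine ⟨2 * k + s, by omega, by omega, ?_⟩
          unfold twoLegs
          split_ifs with h
          · obtain rfl : s = 0 := by omega
            rw [hc 2 1]
            congr 1; omega
          · congr 1; omega
  · refine mbVal_le_of_path_s16 N _ _ (2 * k - 1) (fun t => q 0 (2 + t))
      (by rw [Nat.odd_iff]; omega) (by omega) (fun i hi j hj hij => ?_) (fun i hi => ⟨?_, ?_⟩)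
      (fun i hi => ?_)
    · rw [hs.eq_iff _ _ _ _ (by omega) (by omega)] at hij
      omega
    · exact hne _ _ (by omega) (by omega)
    · simp only [Finset.mem_insert, Finset.notMem_empty, or_false]
      exact fun h => hleg ⟨2 + i, by omega, by omega, h.symm⟩
    · obtain ⟨e, he, hmem⟩ := hex 0 (2 + i) (by omega)
      refine ⟨e, he, fun w hw => ?_⟩
      rcases (hmem w).1 hw with ⟨h, -⟩ | ⟨s, hs', hst, rfl⟩
      · omega
      · by_cases hs1 : s = 1
        · subst hs1; exact Or.inl (Finset.mem_insert_self _ _)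
        · refine Or.inr ⟨s - 2, by omega, by omega, ?_⟩
          congr 1; omega

end IsSpider

end Defence

/-- The vertex at distance `t` from the center on leg `l` of the subdivided star. -/
def legVertex (r : ℕ) (l : Fin 3) (t : ℕ) : Option (Σ _ : Fin 3, Fin r) :=
  if h : 0 < t ∧ t ≤ r then some ⟨l, ⟨t - 1, by omega⟩⟩ else none

theorem legVertex_zero (r : ℕ) (l : Fin 3) : legVertex r l 0 = none := by
  simp [legVertex]

theorem legVertex_succ {r t : ℕ} (l : Fin 3) (ht : t < r) :
    legVertex r l (t + 1) = some ⟨l, ⟨t, ht⟩⟩ := by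
  simp [legVertex, Nat.succ_le_iff.2 ht]

theorem legVertex_eq_iff {r : ℕ} (l l' : Fin 3) (t t' : ℕ) (ht : t ≤ r) (ht' : t' ≤ r) :
    legVertex r l t = legVertex r l' t' ↔ (t = 0 ∧ t' = 0) ∨ (l = l' ∧ t = t') := by
  rcases t with _ | t <;> rcases t' with _ | t'
  · simp [legVertex_zero]
  · simp [legVertex_zero, legVertex_succ l' (show t' < r by omega)]
  · simp [legVertex_zero, legVertex_succ l (show t < r by omega)]
  · rw [legVertex_succ l (show t < r by omega), legVertex_succ l' (show t' < r by omega)]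
    constructor
    · intro h
      simp only [Option.some.injEq, Sigma.mk.injEq] at h
      obtain ⟨rfl, h⟩ := h
      simp at h
      simp [h]
    · rintro (h | ⟨rfl, h⟩)
      · omega
      · obtain rfl : t = t' := by omega
        rfl

theorem exists_legVertex {r : ℕ} (v : Option (Σ _ : Fin 3, Fin r)) :
    ∃ l, ∃ t ≤ r, v = legVertex r l t := by
  rcases v with _ | ⟨l, j, hj⟩
  · exact ⟨0, 0, by omega, (legVertex_zero r 0).symm⟩
  · exact ⟨l, j + 1, by omega, (legVertex_succ l hj).symm⟩

theorem subdividedStar_adj_legVertex {r t : ℕ} (hr : 0 < r) (l : Fin 3) (ht : t ≤ r)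
    (w : Option (Σ _ : Fin 3, Fin r)) :
    w = legVertex r l t ∨ (subdividedStar 3 fun _ => r).Adj (legVertex r l t) w ↔
      (t = 0 ∧ ∃ l', w = legVertex r l' 1) ∨
        ∃ s ≤ r, (s = t ∨ s + 1 = t ∨ s = t + 1) ∧ w = legVertex r l s := by
  have hrel : ∀ a b : Option (Σ _ : Fin 3, Fin r),
      ((∃ (i : Fin 3) (h : 0 < r), a = none ∧ b = some ⟨i, ⟨0, h⟩⟩) ∨
      (∃ (i : Fin 3) (j : Fin r) (hj : (j : ℕ) + 1 < r),
        a = some ⟨i, j⟩ ∧ b = some ⟨i, ⟨(j : ℕ) + 1, hj⟩⟩)) ↔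
      ∃ i, ∃ s < r, a = legVertex r i s ∧ b = legVertex r i (s + 1) := by
    intro a b
    constructor
    · rintro (⟨i, h, rfl, rfl⟩ | ⟨i, ⟨j, hj'⟩, hj, rfl, rfl⟩)
      · exact ⟨i, 0, h, (legVertex_zero r i).symm, (legVertex_succ i h).symm⟩
      · exact ⟨i, j + 1, hj, (legVertex_succ i hj').symm, (legVertex_succ i hj).symm⟩
    · rintro ⟨i, s, hs, rfl, rfl⟩
      rcases s with _ | s
      · exact Or.inl ⟨i, hs, legVertex_zero r i, legVertex_succ i hs⟩
      · exact Or.inr ⟨i, ⟨s, by omega⟩, hs, legVertex_succ i (by omega), legVertex_succ i hs⟩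
  rw [subdividedStar, SimpleGraph.fromRel_adj, hrel, hrel]
  constructor
  · rintro (rfl | ⟨-, ⟨i, s, hs, h1, rfl⟩ | ⟨i, s, hs, rfl, h1⟩⟩)
    · exact Or.inr ⟨t, ht, Or.inl rfl, rfl⟩
    · rcases (legVertex_eq_iff _ _ _ _ ht (by omega)).1 h1 with ⟨rfl, rfl⟩ | ⟨rfl, rfl⟩
      · exact Or.inl ⟨rfl, i, rfl⟩
      · exact Or.inr ⟨t + 1, hs, by omega, rfl⟩
    · rcases (legVertex_eq_iff _ _ _ _ ht (by omega)).1 h1 with ⟨rfl, h⟩ | ⟨rfl, rfl⟩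
      · omega
      · exact Or.inr ⟨s, by omega, by omega, rfl⟩
  · have hc : ∀ l l', legVertex r l 0 = legVertex r l' 0 := fun l l' => by
      rw [legVertex_zero, legVertex_zero]
    rintro (⟨rfl, i, rfl⟩ | ⟨s, hs, rfl | rfl | rfl, rfl⟩)
    · refine Or.inr ⟨?_, Or.inl ⟨i, 0, hr, hc _ _, rfl⟩⟩
      rw [Ne, legVertex_eq_iff _ _ _ _ (by omega) (by omega)]
      omega
    · exact Or.inl rfl
    · refine Or.inr ⟨?_, Or.inr ⟨l, s, ht, rfl, rfl⟩⟩
      rw [Ne, legVertex_eq_iff _ _ _ _ (by omega) (by omega)]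
      omega
    · refine Or.inr ⟨?_, Or.inl ⟨l, t, hs, rfl, rfl⟩⟩
      rw [Ne, legVertex_eq_iff _ _ _ _ (by omega) (by omega)]
      omega

theorem isSpider_subdividedStar {r : ℕ} (hr : 0 < r) :
    IsSpider (nbhdHyp (subdividedStar 3 fun _ => r)) r (legVertex r) where
  eq_iff := legVertex_eq_iff
  surj := exists_legVertex
  nbhd e := by
    constructor
    · rintro ⟨v, rfl⟩
      obtain ⟨l, t, ht, rfl⟩ := exists_legVertex v
      refine ⟨l, t, ht, fun w => ?_⟩
      rw [← subdividedStar_adj_legVertex hr l ht]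
      simp [closedNbhdFinset]
    · rintro ⟨l, t, ht, h⟩
      refine ⟨legVertex r l t, ?_⟩
      ext w
      rw [h, ← subdividedStar_adj_legVertex hr l ht]
      simp [closedNbhdFinset]

/-- For every integer `k ≥ 1`, `γ'_SMB(S(2k, 2k, 2k)) = ⌈log₂(4k+1)⌉ + 1`. -/
theorem stmt_16 (k : ℕ) (hk : 1 ≤ k) :
    gammaSMB' (subdividedStar 3 (fun _ => 2 * k)) =
      (Nat.clog 2 (4 * k + 1) + 1 : ℕ) := by
  have hs := isSpider_subdividedStar (r := 2 * k) (by omega)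
  have hpos : 0 < Nat.clog 2 (4 * k + 1) := Nat.clog_pos (by norm_num) (by omega)
  have hdvd : 2 ∣ 2 ^ Nat.clog 2 (4 * k + 1) := dvd_pow_self 2 (by omega)
  have hle : 4 * k + 1 ≤ 2 ^ Nat.clog 2 (4 * k + 1) := Nat.le_pow_clog (by norm_num) _
  have hlt : 2 ^ (Nat.clog 2 (4 * k + 1) - 1) < 4 * k + 1 :=
    Nat.pow_pred_clog_lt_self (by norm_num) (by omega)
  refine le_antisymm (hs.mbVal_le_succ hk (by omega)) (hs.succ_le_mbVal hk hpos ?_)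
  calc 2 ^ Nat.clog 2 (4 * k + 1) = 2 * 2 ^ (Nat.clog 2 (4 * k + 1) - 1) := by
        rw [← pow_succ', Nat.sub_add_cancel hpos]
    _ ≤ 2 * (4 * k + 1) := Nat.mul_le_mul_left 2 hlt.le
end

section
/- Let T be a caterpillar in which no maximal clean path has odd order (i.e., P_co(T) = ∅). Then T admits a perfect matching. -/
open scoped Classical


/-- A path `P = u₁u₂…u_k` in `T` is clean if `deg_T(u_i) = 2` for `3 ≤ i ≤ k-2`. -/
def IsCleanPath {V : Type} [Fintype V] (T : SimpleGraph V) {u v : V}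
    (P : T.Walk u v) : Prop :=
  P.IsPath ∧ ∀ i : ℕ, 2 ≤ i → i + 3 ≤ P.support.length →
    T.degree (P.support.getD i u) = 2

/-- `P` is an inclusion-maximal path in `T`. -/
def IsMaximalPath {V : Type} (T : SimpleGraph V) {u v : V}
    (P : T.Walk u v) : Prop :=
  P.IsPath ∧ ∀ (a b : V) (Q : T.Walk a b), Q.IsPath →
    P.support.toFinset ⊆ Q.support.toFinset →
    Q.support.toFinset = P.support.toFinset

/-- A caterpillar: a tree on at least three vertices in which a single path is
incident to (or contains) every edge. -/
def IsCaterpillar {V : Type} [Fintype V] (T : SimpleGraph V) : Prop :=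
  T.IsTree ∧ 3 ≤ Fintype.card V ∧ ∃ (u v : V) (P : T.Walk u v), P.IsPath ∧
    ∀ e ∈ T.edgeSet, ∃ x, x ∈ e ∧ x ∈ P.support

/-- `𝒫_co(T)` is nonempty: `T` has an inclusion-maximal clean path of odd order. -/
def HasOddMaximalCleanPath {V : Type} [Fintype V] (T : SimpleGraph V) : Prop :=
  ∃ (u v : V) (P : T.Walk u v), IsCleanPath T P ∧ IsMaximalPath T P ∧
    Odd P.support.length

open SimpleGraph

section Caterpillar

variable {V : Type} {T : SimpleGraph V}

/-- A leaf is a vertex with exactly one neighbour. -/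
def IsLeaf (T : SimpleGraph V) (v : V) : Prop := ∃! w, T.Adj v w

/-- The path `p 0, …, p n` joins two leaves of `T` and passes through every non-leaf. -/
structure IsLeafSpine (T : SimpleGraph V) (n : ℕ) (p : ℕ → V) : Prop where
  two_le : 2 ≤ n
  inj : ∀ a b, a ≤ n → b ≤ n → p a = p b → a = b
  adj : ∀ i, i < n → T.Adj (p i) (p (i + 1))
  eq_succ_of_adj : ∀ a b, a < b → b ≤ n → T.Adj (p a) (p b) → b = a + 1
  leaf_zero : IsLeaf T (p 0)
  leaf_last : IsLeaf T (p n)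
  leaf_or_inner : ∀ v, IsLeaf T v ∨ ∃ i, 1 ≤ i ∧ i < n ∧ v = p i
  exists_segment : ∀ a b, a ≤ b → b ≤ n → ∃ Q : T.Walk (p a) (p b), Q.IsPath ∧
    Q.length = b - a ∧ ∀ k, k ≤ b - a → Q.getVert k = p (a + k)

theorem SimpleGraph.Walk.IsPath.exists_segment {u v : V} {P : T.Walk u v} (hP : P.IsPath)
    {a b : ℕ} (hab : a ≤ b) (hb : b ≤ P.length) :
    ∃ Q : T.Walk (P.getVert a) (P.getVert b), Q.IsPath ∧
      Q.length = b - a ∧ ∀ k, k ≤ b - a → Q.getVert k = P.getVert (a + k) := by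
  have e : (P.drop a).getVert (b - a) = P.getVert b := by
    rw [Walk.drop_getVert]; congr 1; omega
  refine ⟨((P.drop a).take (b - a)).copy rfl e, ?_, ?_, fun k hk => ?_⟩
  · simpa using (hP.drop a).take _
  · simp only [Walk.length_copy, Walk.take_length, Walk.drop_length]; omega
  · simp [Walk.take_getVert, Walk.drop_getVert, hk]

theorem SimpleGraph.IsAcyclic.walk_unique (hT : T.IsAcyclic) {a b : V} {p q : T.Walk a b}
    (hp : p.IsPath) (hq : q.IsPath) : p = q :=
  congrArg Subtype.val ((hT.subsingleton_path a b).elim ⟨p, hp⟩ ⟨q, hq⟩)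

theorem SimpleGraph.IsAcyclic.eq_succ_of_adj_getVert (hT : T.IsAcyclic) {u v : V}
    {P : T.Walk u v} (hP : P.IsPath) {a b : ℕ} (hab : a ≤ b) (hb : b ≤ P.length)
    (h : T.Adj (P.getVert a) (P.getVert b)) : b = a + 1 := by
  obtain ⟨Q, hQ, hl, -⟩ := hP.exists_segment hab hb
  have := hT.walk_unique hQ (p := Q) (q := h.toWalk) (by simp [h.ne])
  rw [this] at hl
  simp at hl
  omega

theorem SimpleGraph.IsAcyclic.eq_of_adj_getVert (hT : T.IsAcyclic) {u v w : V}
    {P : T.Walk u v} (hP : P.IsPath) {a b : ℕ} (hab : a ≤ b) (hb : b ≤ P.length)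
    (hw : w ∉ P.support) (h₁ : T.Adj w (P.getVert a)) (h₂ : T.Adj w (P.getVert b)) :
    P.getVert a = P.getVert b := by
  by_contra hne
  obtain ⟨Q, hQ, hl, hg⟩ := hP.exists_segment hab hb
  have := hT.walk_unique hQ (q := .cons h₁.symm (.cons h₂ .nil)) (by
    simp [Walk.isPath_def, h₁.ne', h₂.ne, hne])
  have hm : w ∈ Q.support := by rw [this]; simp
  obtain ⟨k, rfl, hk⟩ := Walk.mem_support_iff_exists_getVert.1 hm
  rw [hg k (by omega)] at hw
  exact hw (Walk.getVert_mem_support _ _)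

/-- The path `P` is incident to every edge. -/
def IsCoverPath {u v : V} (P : T.Walk u v) : Prop :=
  P.IsPath ∧ ∀ a b, T.Adj a b → a ∈ P.support ∨ b ∈ P.support

theorem IsCoverPath.reverse {u v : V} {P : T.Walk u v} (h : IsCoverPath P) :
    IsCoverPath P.reverse :=
  ⟨h.1.reverse, by simpa using h.2⟩

theorem IsCoverPath.eq_getVert_one (hT : T.IsAcyclic) {u v : V} {P : T.Walk u v}
    (h : IsCoverPath P)
    (hmax : ∀ (a b : V) (Q : T.Walk a b), IsCoverPath Q → Q.length ≤ P.length) {w : V}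
    (hw : T.Adj u w) : w = P.getVert 1 ∧ 1 ≤ P.length := by
  by_cases hm : w ∈ P.support
  · obtain ⟨k, rfl, hk⟩ := Walk.mem_support_iff_exists_getVert.1 hm
    have := hT.eq_succ_of_adj_getVert h.1 (Nat.zero_le k) hk (by simpa using hw)
    subst this
    exact ⟨rfl, hk⟩
  · have := hmax _ _ (.cons hw.symm P) ⟨h.1.cons hm, fun a b hab => by
      have := h.2 a b hab
      simp only [Walk.support_cons, List.mem_cons]
      tauto⟩
    simp at this

theorem IsCaterpillar.exists_isLeafSpine [Fintype V] (hT : IsCaterpillar T) :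
    ∃ n p, IsLeafSpine T n p := by
  obtain ⟨⟨hconn, hac⟩, hcard, u₀, v₀, P₀, hP₀, hinc⟩ := hT
  have : Nontrivial V := Fintype.one_lt_card_iff_nontrivial.1 (by omega)
  have hex : ∃ m, ∃ (u v : V) (P : T.Walk u v), IsCoverPath P ∧ P.length = m := by
    refine ⟨_, u₀, v₀, P₀, ⟨hP₀, fun a b hab => ?_⟩, rfl⟩
    obtain ⟨x, hx, hxP⟩ := hinc s(a, b) hab
    rcases Sym2.mem_iff.1 hx with rfl | rfl <;> tauto
  obtain ⟨u, v, P, hP, hlen⟩ := Nat.sSup_mem hex (by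
    refine ⟨Fintype.card V, ?_⟩
    rintro m ⟨u, v, P, hP, rfl⟩
    exact hP.1.length_lt.le)
  have hmax : ∀ (a b : V) (Q : T.Walk a b), IsCoverPath Q → Q.length ≤ P.length := by
    intro a b Q hQ
    rw [hlen]
    refine le_csSup ⟨Fintype.card V, ?_⟩ ⟨a, b, Q, hQ, rfl⟩
    rintro m ⟨u, v, P, hP, rfl⟩
    exact hP.1.length_lt.le
  have hleaf0 : ∀ w, T.Adj u w → w = P.getVert 1 ∧ 1 ≤ P.length := fun w hw =>
    hP.eq_getVert_one hac hmax hw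
  have hleafn : ∀ w, T.Adj v w → w = P.reverse.getVert 1 ∧ 1 ≤ P.length := fun w hw => by
    simpa using hP.reverse.eq_getVert_one hac (by simpa using hmax) hw
  have hoff : ∀ w, w ∉ P.support → IsLeaf T w := by
    intro w hw
    obtain ⟨x, hx⟩ := hconn.preconnected.exists_adj_of_nontrivial w
    refine ⟨x, hx, fun y hy => ?_⟩
    obtain ⟨a, rfl, ha⟩ := Walk.mem_support_iff_exists_getVert.1 ((hP.2 _ _ hx).resolve_left hw)
    obtain ⟨b, rfl, hb⟩ := Walk.mem_support_iff_exists_getVert.1 ((hP.2 _ _ hy).resolve_left hw)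
    rcases le_total a b with h | h
    · exact (hac.eq_of_adj_getVert hP.1 h hb hw hx hy).symm
    · exact hac.eq_of_adj_getVert hP.1 h ha hw hy hx
  have hu : IsLeaf T u := by
    obtain ⟨x, hx⟩ := hconn.preconnected.exists_adj_of_nontrivial u
    exact ⟨x, hx, fun y hy => (hleaf0 y hy).1.trans (hleaf0 x hx).1.symm⟩
  have hv : IsLeaf T v := by
    obtain ⟨x, hx⟩ := hconn.preconnected.exists_adj_of_nontrivial v
    exact ⟨x, hx, fun y hy => (hleafn y hy).1.trans (hleafn x hx).1.symm⟩
  have hinner : ∀ w ∈ P.support, w ≠ u → w ≠ v → ∃ i, 1 ≤ i ∧ i < P.length ∧ w = P.getVert i := by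
    intro w hw hwu hwv
    obtain ⟨k, rfl, hk⟩ := Walk.mem_support_iff_exists_getVert.1 hw
    have h0 : k ≠ 0 := by rintro rfl; simp at hwu
    have hn : k ≠ P.length := by rintro rfl; simp at hwv
    exact ⟨k, by omega, by omega, rfl⟩
  refine ⟨P.length, P.getVert, ?_, fun a b ha hb h => hP.1.getVert_injOn ha hb h,
    fun i hi => P.adj_getVert_succ hi,
    fun a b hab hb h => hac.eq_succ_of_adj_getVert hP.1 hab.le hb h, by simpa using hu,
    by simpa using hv, fun w => ?_, fun a b hab hb => hP.1.exists_segment hab hb⟩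
  · obtain ⟨z, hz⟩ : ∃ z, z ∉ ({u, v} : Finset V) := by
      by_contra! hz
      have := Finset.card_le_card (fun x _ => hz x : (Finset.univ : Finset V) ⊆ {u, v})
      have := Finset.card_le_two (a := u) (b := v)
      rw [Finset.card_univ] at *
      omega
    simp only [Finset.mem_insert, Finset.mem_singleton, not_or] at hz
    by_cases hzP : z ∈ P.support
    · obtain ⟨i, _, _, _⟩ := hinner z hzP hz.1 hz.2
      omega
    · obtain ⟨x, hx⟩ := hconn.preconnected.exists_adj_of_nontrivial z
      have hxP := (hP.2 _ _ hx).resolve_left hzP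
      obtain ⟨i, _, _, _⟩ := hinner x hxP
        (by rintro rfl; exact hzP ((hleaf0 z hx.symm).1 ▸ P.getVert_mem_support 1))
        (by
          rintro rfl
          have := P.reverse.getVert_mem_support 1
          rw [← (hleafn z hx.symm).1] at this
          simp at this
          exact hzP this)
      omega
  · by_cases hw : w ∈ P.support
    · by_cases hwu : w = u
      · exact .inl (hwu ▸ hu)
      by_cases hwv : w = v
      · exact .inl (hwv ▸ hv)
      exact .inr (hinner w hw hwu hwv)
    · exact .inl (hoff w hw)

theorem SimpleGraph.Walk.IsPath.eq_or_eq_of_isLeaf {a b w : V} {Q : T.Walk a b} (hQ : Q.IsPath)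
    (hw : IsLeaf T w) (hm : w ∈ Q.support) : w = a ∨ w = b := by
  obtain ⟨k, rfl, hk⟩ := Walk.mem_support_iff_exists_getVert.1 hm
  by_contra! hne
  have h0 : k ≠ 0 := by rintro rfl; simp at hne
  have hn : k ≠ Q.length := by rintro rfl; simp at hne
  obtain ⟨m, rfl⟩ := Nat.exists_eq_succ_of_ne_zero h0
  have := hQ.getVert_injOn (by simp; omega) (by simp; omega)
    (hw.unique (Q.adj_getVert_succ (i := m) (by omega)).symm
      (Q.adj_getVert_succ (i := m + 1) (by omega)))
  omega

theorem isMaximalPath_of_isLeaf (hT : T.IsAcyclic) {u v : V} {P : T.Walk u v} (hP : P.IsPath)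
    (hu : IsLeaf T u) (hv : IsLeaf T v) (huv : u ≠ v) : IsMaximalPath T P := by
  refine ⟨hP, fun a b Q hQ hsub => ?_⟩
  have hu' := hQ.eq_or_eq_of_isLeaf hu (by simpa using @hsub u (by simp))
  have hv' := hQ.eq_or_eq_of_isLeaf hv (by simpa using @hsub v (by simp))
  rcases hu' with rfl | rfl <;> rcases hv' with rfl | rfl
  · exact absurd rfl huv
  · rw [hT.walk_unique hP hQ]
  · rw [hT.walk_unique hP hQ.reverse]
    simp
  · exact absurd rfl huv

/-- The vertex `v` has a leaf as a neighbour. -/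
def IsSupport (T : SimpleGraph V) (v : V) : Prop := ∃ w, IsLeaf T w ∧ T.Adj v w

namespace IsLeafSpine

variable {n : ℕ} {p : ℕ → V}

theorem not_isLeaf (S : IsLeafSpine T n p) {i : ℕ} (h1 : 1 ≤ i) (hn : i < n) :
    ¬ IsLeaf T (p i) := by
  intro h
  obtain ⟨k, rfl⟩ := Nat.exists_eq_add_of_le' h1
  have := S.inj _ _ (by omega) (by omega)
    (h.unique (S.adj k (by omega)).symm (S.adj (k + 1) hn))
  omega

theorem adj_inner (S : IsLeafSpine T n p) {i : ℕ} (h1 : 1 ≤ i) (hn : i < n)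
    (hs : ¬ IsSupport T (p i)) (x : V) : T.Adj (p i) x ↔ x = p (i - 1) ∨ x = p (i + 1) := by
  obtain ⟨k, rfl⟩ := Nat.exists_eq_add_of_le' h1
  constructor
  · intro hx
    rcases S.leaf_or_inner x with h | ⟨j, hj1, hjn, rfl⟩
    · exact absurd ⟨x, h, hx⟩ hs
    · rcases lt_trichotomy j (k + 1) with h | rfl | h
      · have := S.eq_succ_of_adj _ _ h hn.le hx.symm
        left; congr 1; omega
      · exact absurd hx (T.irrefl)
      · have := S.eq_succ_of_adj _ _ h hjn.le hx
        right; congr 1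
  · rintro (rfl | rfl)
    · exact (S.adj k (by omega)).symm
    · exact S.adj _ hn

theorem degree_inner [Fintype V] (S : IsLeafSpine T n p) {i : ℕ} (h1 : 1 ≤ i) (hn : i < n)
    (hs : ¬ IsSupport T (p i)) : T.degree (p i) = 2 := by
  have : T.neighborFinset (p i) = {p (i - 1), p (i + 1)} := by
    ext x
    simp [S.adj_inner h1 hn hs]
  rw [← card_neighborFinset_eq_degree, this, Finset.card_pair]
  intro h
  have := S.inj _ _ (by omega) (by omega) h
  omega

theorem odd_sub [Fintype V] (hT : T.IsAcyclic) (hodd : ¬ HasOddMaximalCleanPath T)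
    (S : IsLeafSpine T n p) {i j : ℕ} (h1 : 1 ≤ i) (hij : i ≤ j) (hn : j < n) {w w' : V}
    (hw : IsLeaf T w) (hw' : IsLeaf T w') (hne : w ≠ w') (hiw : T.Adj (p i) w)
    (hjw : T.Adj (p j) w') (hs : ∀ m, i < m → m < j → ¬ IsSupport T (p m)) :
    Odd (j - i) := by
  by_contra hev
  obtain ⟨Q, hQ, hl, hg⟩ := S.exists_segment i j hij hn.le
  have hnot : ∀ x, IsLeaf T x → x ∉ Q.support := by
    intro x hx hm
    obtain ⟨k, rfl, hk⟩ := Walk.mem_support_iff_exists_getVert.1 hm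
    rw [hg k (by omega)] at hx
    exact S.not_isLeaf (by omega) (by omega) hx
  have hW : (Walk.cons hiw.symm (Q.concat hjw)).IsPath := by
    refine (hQ.concat (hnot _ hw') hjw).cons ?_
    simp [Walk.support_concat, hnot _ hw, hne]
  refine hodd ⟨w, w', _, ⟨hW, fun m hm hm' => ?_⟩, isMaximalPath_of_isLeaf hT hW hw hw' hne, ?_⟩
  · simp only [Walk.length_support, Walk.length_cons, Walk.length_concat, hl] at hm'
    obtain ⟨k, rfl⟩ := Nat.exists_eq_add_of_le' (show 1 ≤ m by omega)
    rw [List.getD_eq_getElem _ _ (by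
        simp only [Walk.length_support, Walk.length_cons, Walk.length_concat]; omega),
      Walk.support_getElem_eq_getVert, Walk.getVert_cons_succ, Walk.concat_eq_append,
      Walk.getVert_append, if_pos (by omega), hg k (by omega)]
    exact S.degree_inner (by omega) (by omega) (hs _ (by omega) (by omega))
  · simp only [Walk.length_support, Walk.length_cons, Walk.length_concat, hl]
    grind

end IsLeafSpine

/-- Along `p`, decides whether `p i` is matched to `p (i + 1)`: this happens exactly when neither
`p i` is a support vertex nor `p (i - 1)` is matched to `p i`. -/
def MatchedNext (T : SimpleGraph V) (p : ℕ → V) : ℕ → Prop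
  | 0 => False
  | i + 1 => ¬ MatchedNext T p i ∧ ¬ IsSupport T (p (i + 1))

namespace IsLeafSpine

variable {n : ℕ} {p : ℕ → V}

theorem isSupport_one (S : IsLeafSpine T n p) : IsSupport T (p 1) :=
  ⟨p 0, S.leaf_zero, (S.adj 0 (by have := S.two_le; omega)).symm⟩

theorem isSupport_pred_last (S : IsLeafSpine T n p) : IsSupport T (p (n - 1)) := by
  have := S.two_le
  refine ⟨p n, S.leaf_last, ?_⟩
  simpa [show n - 1 + 1 = n by omega] using S.adj (n - 1) (by omega)

theorem matchedNext_iff (S : IsLeafSpine T n p) {i : ℕ} (h1 : 1 ≤ i) :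
    ∃ j, 1 ≤ j ∧ j ≤ i ∧ IsSupport T (p j) ∧ (∀ m, j < m → m ≤ i → ¬ IsSupport T (p m)) ∧
      (MatchedNext T p i ↔ Odd (i - j)) := by
  induction i, h1 using Nat.le_induction with
  | base => exact ⟨1, le_rfl, le_rfl, S.isSupport_one, by omega, by
      simp [MatchedNext, S.isSupport_one]⟩
  | succ i h1 ih =>
    by_cases hs : IsSupport T (p (i + 1))
    · exact ⟨i + 1, by omega, le_rfl, hs, by omega, by simp [MatchedNext, hs]⟩
    · obtain ⟨j, hj1, hji, hj, hm, hiff⟩ := ih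
      refine ⟨j, hj1, by omega, hj, fun m h h' => ?_, ?_⟩
      · rcases Nat.lt_or_ge i m with h'' | h''
        · obtain rfl : m = i + 1 := by omega
          exact hs
        · exact hm m h h''
      · rw [MatchedNext, hiff, Nat.succ_sub hji, Nat.succ_eq_add_one, Nat.odd_add_one]
        tauto

theorem not_isSupport_succ [Fintype V] (hT : T.IsAcyclic) (hodd : ¬ HasOddMaximalCleanPath T)
    (S : IsLeafSpine T n p) {i : ℕ} (hn : i + 1 < n) (h : MatchedNext T p i) :
    ¬ IsSupport T (p (i + 1)) := by
  rintro ⟨w', hw', hadj'⟩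
  have h1 : 1 ≤ i := Nat.one_le_iff_ne_zero.2 (by rintro rfl; exact h)
  obtain ⟨j, hj1, hji, ⟨w, hw, hadj⟩, hm, hiff⟩ := S.matchedNext_iff h1
  have hne : w ≠ w' := by
    rintro rfl
    have := S.inj _ _ (by omega) (by omega) (hw.unique hadj.symm hadj'.symm)
    omega
  have h2 := S.odd_sub hT hodd hj1 (by omega) hn hw hw' hne hadj hadj'
    fun m h h' => hm m h (by omega)
  have h3 := hiff.1 h
  rw [Nat.succ_sub hji, Nat.succ_eq_add_one, Nat.odd_add_one] at h2
  exact h2 h3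

/-- The pendant edges together with the edges `p i p (i + 1)` selected by `MatchedNext`. -/
def matching (T : SimpleGraph V) (n : ℕ) (p : ℕ → V) : T.Subgraph where
  verts := Set.univ
  Adj a b := T.Adj a b ∧ (IsLeaf T a ∨ IsLeaf T b ∨
    ∃ i, i + 1 < n ∧ MatchedNext T p i ∧ (a = p i ∧ b = p (i + 1) ∨ a = p (i + 1) ∧ b = p i))
  adj_sub h := h.1
  edge_vert _ := Set.mem_univ _
  symm := ⟨fun a b ⟨h, h'⟩ => ⟨h.symm, by
    rcases h' with h' | h' | ⟨i, hi, hm, h'⟩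
    · exact .inr (.inl h')
    · exact .inl h'
    · exact .inr (.inr ⟨i, hi, hm, by tauto⟩)⟩⟩

theorem isPerfectMatching_matching [Fintype V] (hT : T.IsAcyclic)
    (hodd : ¬ HasOddMaximalCleanPath T) (S : IsLeafSpine T n p) :
    (matching T n p).IsPerfectMatching := by
  rw [Subgraph.isPerfectMatching_iff]
  intro v
  by_cases hv : IsLeaf T v
  · exact ⟨hv.choose, ⟨hv.choose_spec.1, .inl hv⟩, fun y hy => hv.choose_spec.2 y hy.1⟩
  obtain ⟨i, h1, hn, rfl⟩ := (S.leaf_or_inner v).resolve_left hv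
  obtain ⟨k, rfl⟩ := Nat.exists_eq_add_of_le' h1
  have hcases : ∀ y, (matching T n p).Adj (p (k + 1)) y → IsLeaf T y ∨
      (MatchedNext T p (k + 1) ∧ y = p (k + 2)) ∨ (MatchedNext T p k ∧ y = p k) := by
    rintro y ⟨-, h | h | ⟨i, hi, hm, ⟨h, rfl⟩ | ⟨h, rfl⟩⟩⟩
    · exact absurd h hv
    · exact .inl h
    · obtain rfl := S.inj _ _ hn.le (by omega) h
      exact .inr (.inl ⟨hm, rfl⟩)
    · obtain rfl : k = i := by
        have := S.inj _ _ hn.le (by omega) h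
        omega
      exact .inr (.inr ⟨hm, rfl⟩)
  by_cases hs : IsSupport T (p (k + 1))
  · have hk : ¬ MatchedNext T p k := fun h => S.not_isSupport_succ hT hodd hn h hs
    have hk' : ¬ MatchedNext T p (k + 1) := fun h => h.2 hs
    obtain ⟨w, hw, hadj⟩ := hs
    refine ⟨w, ⟨hadj, .inr (.inl hw)⟩, fun y hy => ?_⟩
    have hyl : IsLeaf T y := by have := hcases y hy; tauto
    by_contra hne
    simpa using S.odd_sub hT hodd h1 le_rfl hn hyl hw hne hy.1 hadj (by omega)
  · have hyl : ∀ y, (matching T n p).Adj (p (k + 1)) y → ¬ IsLeaf T y :=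
      fun y hy h => hs ⟨y, h, hy.1⟩
    by_cases hk : MatchedNext T p k
    · refine ⟨p k, ⟨(S.adj k (by omega)).symm, .inr (.inr ⟨k, hn, hk, by tauto⟩)⟩,
        fun y hy => ?_⟩
      rcases hcases y hy with h | h | h
      · exact absurd h (hyl y hy)
      · exact absurd hk h.1.1
      · exact h.2
    · have hlast : k + 2 < n := by
        by_contra hlt
        refine hs ?_
        have := S.isSupport_pred_last
        rwa [show n - 1 = k + 1 by omega] at this
      refine ⟨p (k + 2), ⟨S.adj (k + 1) hn, .inr (.inr ⟨k + 1, hlast, ⟨hk, hs⟩, by tauto⟩)⟩,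
        fun y hy => ?_⟩
      rcases hcases y hy with h | h | h
      · exact absurd h (hyl y hy)
      · exact h.2
      · exact absurd h.1 hk

end IsLeafSpine

end Caterpillar

/-- A caterpillar with no odd-order inclusion-maximal clean path
(`𝒫_co(T) = ∅`) admits a perfect matching. -/
theorem stmt_17 {V : Type} [Fintype V] (T : SimpleGraph V)
    (hT : IsCaterpillar T) (h : ¬ HasOddMaximalCleanPath T) :
    ∃ M : T.Subgraph, M.IsPerfectMatching := by
  obtain ⟨n, p, S⟩ := hT.exists_isLeafSpine
  exact ⟨_, S.isPerfectMatching_matching hT.1.isAcyclic h⟩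
end
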